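/- Suppose [α,γ] interval pattern embeds into [β,θ] (clans α ≤ γ in Clans_{p,q}, β ≤ θ in Clans_{r,s}) via index set I, and let J be the complement of I in {1,…,r+s}. Let Ψ send an (r+s)×(r+s) matrix M to the (p+q)×(p+q) matrix obtained by deleting row j and column w_β(j) for every j ∈ J. Then Ψ restricts to a bijection from the Mars–Springer variety N_{θ,β} onto the Mars–Springer variety N_{γ,α} (so N_{θ,β} ≅ N_{γ,α}). -/

import Mathlib

noncomputable section
open scoped Classical

/-- A `(p,q)`-clan: a partial matching of `{0,…,p+q-1}` (encoded by the involution `mate`)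
together with a sign (`true` = `+`, `false` = `-`) at each unmatched position, such that
`#(+) - #(-) = p - q`.  Matched positions carry the junk sign `true`. -/
structure Clan (p q : ℕ) where
  mate : Fin (p + q) → Fin (p + q)
  mate_invol : ∀ i, mate (mate i) = i
  sign : Fin (p + q) → Bool
  sign_matched : ∀ i, mate i ≠ i → sign i = true
  plus_minus :
    (Finset.univ.filter fun i => mate i = i ∧ sign i = true).card + q
      = (Finset.univ.filter fun i => mate i = i ∧ sign i = false).card + p

namespace Clan

variable {p q r s : ℕ}

/-- position `i` carries a `+`. -/
def IsPlus (c : Clan p q) (i : Fin (p + q)) : Prop :=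
  c.mate i = i ∧ c.sign i = true

/-- position `i` carries a `-`. -/
def IsMinus (c : Clan p q) (i : Fin (p + q)) : Prop :=
  c.mate i = i ∧ c.sign i = false

/-- position `i` is the left end of a matching. -/
def IsLeft (c : Clan p q) (i : Fin (p + q)) : Prop :=
  i < c.mate i

/-- position `i` is the right end of a matching. -/
def IsRight (c : Clan p q) (i : Fin (p + q)) : Prop :=
  c.mate i < i

/-- `(i < j)` is a matching of the clan `c`. -/
def IsMatch (c : Clan p q) (i j : Fin (p + q)) : Prop :=
  i < j ∧ c.mate i = j

/-- The length `ℓ(c)` of a clan: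
`ℓ(c) = Σ_{(i<j) matching} (j - i - #{matchings (s<t) with s < i < t < j})`. -/
def len (c : Clan p q) : ℤ :=
  ∑ ij ∈ Finset.univ.filter (fun ij : Fin (p + q) × Fin (p + q) => c.IsMatch ij.1 ij.2),
    (((ij.2 : ℕ) : ℤ) - ((ij.1 : ℕ) : ℤ) -
      ((Finset.univ.filter (fun st : Fin (p + q) × Fin (p + q) =>
          c.IsMatch st.1 st.2 ∧ st.1 < ij.1 ∧ ij.1 < st.2 ∧ st.2 < ij.2)).card : ℤ))

/-- `c` and `c'` agree (same symbols, same matchings) at every position outside `S`. -/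
def AgreeOutside (c c' : Clan p q) (S : Set (Fin (p + q))) : Prop :=
  ∀ i, i ∉ S → c.mate i = c'.mate i ∧ c.sign i = c'.sign i

/-- `c'` is obtained from `c` by one of the transpositions (T.1)–(T.10). -/
def Transposition (c c' : Clan p q) : Prop :=
  -- (T.1)  +- ↦ 11
  (∃ a b, a < b ∧ c.IsPlus a ∧ c.IsMinus b ∧ c'.IsMatch a b ∧
      AgreeOutside c c' {a, b}) ∨
  -- (T.2)  -+ ↦ 11
  (∃ a b, a < b ∧ c.IsMinus a ∧ c.IsPlus b ∧ c'.IsMatch a b ∧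
      AgreeOutside c c' {a, b}) ∨
  -- (T.3)  11+ ↦ 1+1
  (∃ a b d, c.IsMatch a b ∧ b < d ∧ c.IsPlus d ∧ c'.IsMatch a d ∧ c'.IsPlus b ∧
      AgreeOutside c c' {a, b, d}) ∨
  -- (T.4)  11- ↦ 1-1
  (∃ a b d, c.IsMatch a b ∧ b < d ∧ c.IsMinus d ∧ c'.IsMatch a d ∧ c'.IsMinus b ∧
      AgreeOutside c c' {a, b, d}) ∨
  -- (T.5)  +11 ↦ 1+1
  (∃ a b d, c.IsPlus a ∧ a < b ∧ c.IsMatch b d ∧ c'.IsMatch a d ∧ c'.IsPlus b ∧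
      AgreeOutside c c' {a, b, d}) ∨
  -- (T.6)  -11 ↦ 1-1
  (∃ a b d, c.IsMinus a ∧ a < b ∧ c.IsMatch b d ∧ c'.IsMatch a d ∧ c'.IsMinus b ∧
      AgreeOutside c c' {a, b, d}) ∨
  -- (T.7)  1122 ↦ 1212
  (∃ i j k l, c.IsMatch i j ∧ j < k ∧ c.IsMatch k l ∧ c'.IsMatch i k ∧ c'.IsMatch j l ∧
      AgreeOutside c c' {i, j, k, l}) ∨
  -- (T.8)  1122 ↦ 1+-1
  (∃ i j k l, c.IsMatch i j ∧ j < k ∧ c.IsMatch k l ∧ c'.IsMatch i l ∧ c'.IsPlus j ∧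
      c'.IsMinus k ∧ AgreeOutside c c' {i, j, k, l}) ∨
  -- (T.9)  1122 ↦ 1-+1
  (∃ i j k l, c.IsMatch i j ∧ j < k ∧ c.IsMatch k l ∧ c'.IsMatch i l ∧ c'.IsMinus j ∧
      c'.IsPlus k ∧ AgreeOutside c c' {i, j, k, l}) ∨
  -- (T.10) 1212 ↦ 1221
  (∃ i j k l, i < j ∧ j < k ∧ k < l ∧ c.IsMatch i k ∧ c.IsMatch j l ∧ c'.IsMatch i l ∧
      c'.IsMatch j k ∧ AgreeOutside c c' {i, j, k, l})

/-- Bruhat order `≤` on clans: generated by transpositions. -/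
def ble (c c' : Clan p q) : Prop :=
  Relation.ReflTransGen Transposition c c'

/-- Strict Bruhat order `<` on clans. -/
def blt (c c' : Clan p q) : Prop :=
  Relation.TransGen Transposition c c'

/-- Covering relation: `c ⋖ c'` iff `c < c'` and `ℓ(c') = ℓ(c) + 1`. -/
def Covers (c c' : Clan p q) : Prop :=
  blt c c' ∧ c'.len = c.len + 1

/-- `θ` pattern contains `γ` via the strictly increasing index map `ι`. -/
def Pattern (θ : Clan r s) (γ : Clan p q) (ι : Fin (p + q) → Fin (r + s)) : Prop :=
  StrictMono ι ∧
  (∀ j, γ.mate j = j → θ.mate (ι j) = ι j ∧ θ.sign (ι j) = γ.sign j) ∧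
  (∀ k l, γ.IsMatch k l → θ.IsMatch (ι k) (ι l))

/-- `φ` agrees with `θ` at every position outside the range of `ι`. -/
def AgreesWithOutside (φ θ : Clan r s) (ι : Fin (p + q) → Fin (r + s)) : Prop :=
  ∀ m, (∀ k, ι k ≠ m) → φ.mate m = θ.mate m ∧ φ.sign m = θ.sign m

/-- `[α,γ]` interval pattern embeds into `[β,θ]` via `ι`. -/
def IntervalEmbed (α γ : Clan p q) (β θ : Clan r s)
    (ι : Fin (p + q) → Fin (r + s)) : Prop :=
  Pattern θ γ ι ∧ Pattern β α ι ∧ AgreesWithOutside β θ ι ∧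
  θ.len - β.len = γ.len - α.len

/-- `θ` interval pattern contains `[α,γ]`. -/
def IntervalContains (θ : Clan r s) (α γ : Clan p q) : Prop :=
  ∃ (ι : Fin (p + q) → Fin (r + s)) (φ : Clan r s), IntervalEmbed α γ φ θ ι

/-- `γ(i;+)` (here `i` is the number of initial positions considered, i.e. `i` is 1-indexed):
number of `+`'s plus number of matchings entirely among the first `i` positions. -/
def statPlus (c : Clan p q) (i : ℕ) : ℕ :=
  (Finset.univ.filter fun j : Fin (p + q) => (j : ℕ) < i ∧ c.IsPlus j).card +
  (Finset.univ.filter fun ab : Fin (p + q) × Fin (p + q) =>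
      c.IsMatch ab.1 ab.2 ∧ (ab.2 : ℕ) < i).card

/-- `γ(i;-)`, as in `statPlus` with `-`'s. -/
def statMinus (c : Clan p q) (i : ℕ) : ℕ :=
  (Finset.univ.filter fun j : Fin (p + q) => (j : ℕ) < i ∧ c.IsMinus j).card +
  (Finset.univ.filter fun ab : Fin (p + q) × Fin (p + q) =>
      c.IsMatch ab.1 ab.2 ∧ (ab.2 : ℕ) < i).card

/-- `γ(i;j)` (with `i < j` 1-indexed): number of matchings with left endpoint weakly left
of `i` and right endpoint strictly right of `j`. -/
def statMid (c : Clan p q) (i j : ℕ) : ℕ :=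
  (Finset.univ.filter fun ab : Fin (p + q) × Fin (p + q) =>
      c.IsMatch ab.1 ab.2 ∧ (ab.1 : ℕ) < i ∧ j ≤ (ab.2 : ℕ)).card

/-- The permutation `w_c` associated to a clan `c`, 0-indexed: positions carrying a `+` or a
left endpoint get (in left-to-right order) the values `0,…,p-1`; the remaining values
`p,…,p+q-1` are assigned, scanning left to right, to each `-` as it is encountered and to the
right end of each matching as soon as its left end is encountered. -/
def wNat (c : Clan p q) (i : Fin (p + q)) : ℕ :=
  if c.IsPlus i ∨ c.IsLeft i then
    (Finset.univ.filter fun j : Fin (p + q) => (c.IsPlus j ∨ c.IsLeft j) ∧ j < i).card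
  else
    p + (Finset.univ.filter fun j : Fin (p + q) =>
        (c.IsMinus j ∨ c.IsLeft j) ∧ j < (if c.IsMinus i then i else c.mate i)).card

/-- Membership in the affine space `S_c`: the conditions (O.1)–(O.3) and (Z.1)–(Z.9). -/
def MemS (c : Clan p q) (M : Matrix (Fin (p + q)) (Fin (p + q)) ℂ) : Prop :=
  -- (O.1)
  (∀ i j : Fin (p + q), c.mate i = i → (j : ℕ) = c.wNat i → M i j = 1) ∧
  -- (O.2)
  (∀ i i' j : Fin (p + q), c.IsMatch i i' →
      ((j : ℕ) = c.wNat i ∨ (j : ℕ) = c.wNat i') → M i j = 1) ∧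
  -- (O.3)
  (∀ i i' j : Fin (p + q), c.IsMatch i i' → (j : ℕ) = c.wNat i → M i' j = -1) ∧
  (∀ i i' j : Fin (p + q), c.IsMatch i i' → (j : ℕ) = c.wNat i' → M i' j = 1) ∧
  -- (Z.1): first p columns, rows containing a pivot (rows of +'s and of left endpoints)
  (∀ i j : Fin (p + q), (c.IsPlus i ∨ c.IsLeft i) → (j : ℕ) < p →
      (j : ℕ) ≠ c.wNat i → M i j = 0) ∧
  -- (Z.2): above a pivot, first p columns
  (∀ i x j : Fin (p + q), (c.IsPlus i ∨ c.IsLeft i) → (j : ℕ) = c.wNat i →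
      x < i → M x j = 0) ∧
  -- (Z.3): between the pivot 1 and the -1 of a column
  (∀ i i' x j : Fin (p + q), c.IsMatch i i' → (j : ℕ) = c.wNat i →
      i < x → x < i' → M x j = 0) ∧
  -- (Z.4): right of a -1, within the first p columns
  (∀ i i' j : Fin (p + q), c.IsMatch i i' → c.wNat i < (j : ℕ) → (j : ℕ) < p →
      M i' j = 0) ∧
  -- (Z.5): last q columns, rows containing a pivot (rows of -'s and of left endpoints)
  (∀ i j : Fin (p + q), c.IsMinus i → p ≤ (j : ℕ) → (j : ℕ) ≠ c.wNat i → M i j = 0) ∧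
  (∀ i i' j : Fin (p + q), c.IsMatch i i' → p ≤ (j : ℕ) → (j : ℕ) ≠ c.wNat i' →
      M i j = 0) ∧
  -- (Z.6): above a pivot, last q columns
  (∀ i x j : Fin (p + q), c.IsMinus i → (j : ℕ) = c.wNat i → x < i → M x j = 0) ∧
  (∀ i i' x j : Fin (p + q), c.IsMatch i i' → (j : ℕ) = c.wNat i' → x < i → M x j = 0) ∧
  -- (Z.7): between the pivot 1 and the second 1 of a column
  (∀ i i' x j : Fin (p + q), c.IsMatch i i' → (j : ℕ) = c.wNat i' →
      i < x → x < i' → M x j = 0) ∧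
  -- (Z.8): right of a second-1-of-its-column
  (∀ i i' j : Fin (p + q), c.IsMatch i i' → c.wNat i' < (j : ℕ) → M i' j = 0) ∧
  -- (Z.9): identification for 1212 patterns
  (∀ i j k l ci ck : Fin (p + q), c.IsMatch i k → c.IsMatch j l →
      i < j → j < k → k < l → (ci : ℕ) = c.wNat i → (ck : ℕ) = c.wNat k →
      M l ck = - M l ci)

/-- Rank of the southwest `(n-i) × p` submatrix of `M` (`i` 1-indexed from `1` to `n`). -/
def swRank (p q : ℕ) (M : Matrix (Fin (p + q)) (Fin (p + q)) ℂ) (i : ℕ) : ℕ :=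
  Matrix.rank (Matrix.of fun (x : Fin (p + q - i)) (y : Fin p) =>
    M ⟨i + (x : ℕ), by have := x.isLt; omega⟩ ⟨(y : ℕ), by have := y.isLt; omega⟩)

/-- Rank of the southeast `(n-i) × q` submatrix of `M`. -/
def seRank (p q : ℕ) (M : Matrix (Fin (p + q)) (Fin (p + q)) ℂ) (i : ℕ) : ℕ :=
  Matrix.rank (Matrix.of fun (x : Fin (p + q - i)) (y : Fin q) =>
    M ⟨i + (x : ℕ), by have := x.isLt; omega⟩ ⟨p + (y : ℕ), by have := y.isLt; omega⟩)

/-- Rank of the auxiliary matrix `M^{[i;j]}`: its first `i` columns are the first `i` columns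
of `M⁻¹` with the last `q` rows zeroed out, its last `j` columns are the first `j` columns
of `M⁻¹`. -/
def auxRank (p q : ℕ) (M : Matrix (Fin (p + q)) (Fin (p + q)) ℂ) (i j : ℕ) : ℕ :=
  Matrix.rank (Matrix.of fun (x : Fin (p + q)) (y : Fin i ⊕ Fin j) =>
    Sum.elim
      (fun a : Fin i =>
        if p ≤ (x : ℕ) then (0 : ℂ)
        else if h : (a : ℕ) < p + q then M⁻¹ x ⟨(a : ℕ), h⟩ else 0)
      (fun b : Fin j =>
        if h : (b : ℕ) < p + q then M⁻¹ x ⟨(b : ℕ), h⟩ else 0) y)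

/-- The Mars–Springer variety `N_{θ,c}`: matrices of `S_c` satisfying the rank
conditions (R.1)–(R.3) attached to `θ`. -/
def MarsSpringer (θ c : Clan p q) (M : Matrix (Fin (p + q)) (Fin (p + q)) ℂ) : Prop :=
  MemS c M ∧
  (∀ i : ℕ, 1 ≤ i → i ≤ p + q → swRank p q M i ≤ p - statPlus θ i) ∧
  (∀ i : ℕ, 1 ≤ i → i ≤ p + q → seRank p q M i ≤ q - statMinus θ i) ∧
  (∀ i j : ℕ, 1 ≤ i → i < j → j ≤ p + q → auxRank p q M i j ≤ j + statMid θ i j)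

/-- The linear relations defining the coordinates `λ_{k,a}`:
`e_k + Σ_{a ≥ p} λ_{k,a} v_a = Σ_{a < p} λ_{k,a} v_a`, where `v_a` are the columns of `M`. -/
def LambdaRel (p q : ℕ) (M : Matrix (Fin (p + q)) (Fin (p + q)) ℂ)
    (lam : Fin (p + q) → Fin (p + q) → ℂ) : Prop :=
  ∀ k x : Fin (p + q),
    (if x = k then (1 : ℂ) else 0) +
        ∑ a ∈ Finset.univ.filter (fun a : Fin (p + q) => p ≤ (a : ℕ)), lam k a * M x a
      = ∑ a ∈ Finset.univ.filter (fun a : Fin (p + q) => (a : ℕ) < p), lam k a * M x a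

/-- The base point of `S_c`: all free entries set to `0`. -/
def basePoint (c : Clan p q) : Matrix (Fin (p + q)) (Fin (p + q)) ℂ :=
  Matrix.of fun i j =>
    if (j : ℕ) = c.wNat i then 1
    else if c.mate i ≠ i ∧ (j : ℕ) = c.wNat (c.mate i) then
      (if c.mate i < i then -1 else 1)
    else 0

/-- The diagonal matrix `I_{p,q}` with `p` ones followed by `q` negative ones. -/
def Ipq (p q : ℕ) : Matrix (Fin (p + q)) (Fin (p + q)) ℂ :=
  Matrix.diagonal fun i => if (i : ℕ) < p then 1 else -1

end Clan

namespace Clan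

variable {p q r s : ℕ}

/-- Position `k` labels one of the first `p` columns: it is a `+` or a left endpoint. -/
def IsPos (c : Clan p q) (k : Fin (p + q)) : Prop :=
  c.IsPlus k ∨ c.IsLeft k

/-- The type of a position: a sign or an endpoint of a matching. -/
theorem position_cases (c : Clan p q) (k : Fin (p + q)) :
    (c.mate k = k ∧ c.IsPlus k ∧ c.IsPos k) ∨ (c.mate k = k ∧ c.IsMinus k ∧ ¬ c.IsPos k) ∨
    (k < c.mate k ∧ c.IsPos k) ∨ (c.mate k < k ∧ ¬ c.IsPos k) := by
  unfold IsPos IsPlus IsMinus IsLeft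
  rcases lt_trichotomy (c.mate k) k with h | h | h
  · simp [h, h.ne, not_lt.2 h.le]
  · cases hs : c.sign k <;> simp [h]
  · simp [h]

theorem isPos_of_lt {c : Clan p q} {k : Fin (p + q)} (h : k < c.mate k) : c.IsPos k :=
  Or.inr h

theorem not_isPos_of_lt {c : Clan p q} {k : Fin (p + q)} (h : c.mate k < k) : ¬ c.IsPos k := by
  rintro (⟨h', -⟩ | h')
  · exact h.ne h'
  · exact absurd h' (not_lt.2 h.le)

theorem not_isPos_mate {c : Clan p q} {k : Fin (p + q)} (h : k < c.mate k) :
    ¬ c.IsPos (c.mate k) := not_isPos_of_lt (by rwa [c.mate_invol])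

/-- The conditions defining `S_c`, for a matrix whose columns have been relabelled by positions. -/
structure Slice (c : Clan p q) (N : Matrix (Fin (p + q)) (Fin (p + q)) ℂ) : Prop where
  diag : ∀ i, N i i = 1
  left : ∀ i, i < c.mate i → N i (c.mate i) = 1
  right : ∀ i, i < c.mate i → N (c.mate i) i = -1
  plus_row : ∀ i k, c.IsPlus i → c.IsPos k → k ≠ i → N i k = 0
  minus_row : ∀ i k, c.IsMinus i → ¬ c.IsPos k → k ≠ i → N i k = 0
  left_row : ∀ i k, i < c.mate i → k ≠ i → k ≠ c.mate i → N i k = 0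
  above : ∀ x k, x < k → x < c.mate k → N x k = 0
  between : ∀ x k, k < x → x < c.mate k → N x k = 0
  between' : ∀ x k, c.mate k < x → x < k → N x k = 0
  right_row : ∀ i k, i < c.mate i → i < k → i < c.mate k → N (c.mate i) k = 0
  cross : ∀ i j, i < j → j < c.mate i → c.mate i < c.mate j →
    N (c.mate j) (c.mate i) = - N (c.mate j) i

/-- Restriction of a coordinate vector to a set of positions, extended by zero. -/
def part (T : Fin (p + q) → Prop) (x : Fin (p + q) → ℂ) : Fin (p + q) → ℂ :=
  fun k => if T k then x k else 0

theorem part_add_part_not (T : Fin (p + q) → Prop) (x : Fin (p + q) → ℂ) :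
    part T x + part (fun k => ¬ T k) x = x := by
  funext k
  by_cases h : T k <;> simp [part, h]

/-- Coordinate vectors `x` such that the vector with coordinates `x` lies in the span of the first
`i` standard basis vectors and its projection to the span of the columns of positive type lies
in the span of the first `j` standard basis vectors. -/
def flagKer (c : Clan p q) (N : Matrix (Fin (p + q)) (Fin (p + q)) ℂ) (i j : ℕ) :
    Submodule ℂ (Fin (p + q) → ℂ) where
  carrier := {x | (∀ m : Fin (p + q), i ≤ m → (N.mulVec x) m = 0) ∧
    (∀ m : Fin (p + q), j ≤ m → (N.mulVec (part c.IsPos x)) m = 0)}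
  add_mem' := by
    rintro x y ⟨hx, hx'⟩ ⟨hy, hy'⟩
    have : part c.IsPos (x + y) = part c.IsPos x + part c.IsPos y := by
      funext k; simp only [part, Pi.add_apply]; split_ifs <;> simp
    refine ⟨fun m hm => ?_, fun m hm => ?_⟩
    · simp [Matrix.mulVec_add, hx m hm, hy m hm]
    · simp [this, Matrix.mulVec_add, hx' m hm, hy' m hm]
  zero_mem' := by
    have : part c.IsPos (0 : Fin (p + q) → ℂ) = 0 := by
      funext k; simp [part]
    simp [this]
  smul_mem' := by
    rintro a x ⟨hx, hx'⟩
    have : part c.IsPos (a • x) = a • part c.IsPos x := by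
      funext k; simp [part]
    refine ⟨fun m hm => ?_, fun m hm => ?_⟩
    · simp [Matrix.mulVec_smul, hx m hm]
    · simp [this, Matrix.mulVec_smul, hx' m hm]

theorem mulVec_neg_part {c : Clan p q} {N : Matrix (Fin (p + q)) (Fin (p + q)) ℂ} {i j : ℕ}
    (hij : i ≤ j) {x : Fin (p + q) → ℂ} (hx : x ∈ flagKer c N i j) (m : Fin (p + q))
    (hm : j ≤ m) : (N.mulVec (part (fun k => ¬ c.IsPos k) x)) m = 0 := by
  have h1 := hx.1 m (hij.trans hm)
  rw [← part_add_part_not c.IsPos x, Matrix.mulVec_add, Pi.add_apply, hx.2 m hm, zero_add] at h1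
  exact h1

theorem mulVec_eq_single {N : Matrix (Fin (p + q)) (Fin (p + q)) ℂ} {y : Fin (p + q) → ℂ}
    {m : Fin (p + q)} (a : Fin (p + q)) (h : ∀ k, k ≠ a → N m k * y k = 0) :
    (N.mulVec y) m = N m a * y a :=
  Fintype.sum_eq_single a h

theorem mulVec_eq_add {N : Matrix (Fin (p + q)) (Fin (p + q)) ℂ} {y : Fin (p + q) → ℂ}
    {m : Fin (p + q)} (a b : Fin (p + q)) (hab : a ≠ b)
    (h : ∀ k, k ≠ a → k ≠ b → N m k * y k = 0) :
    (N.mulVec y) m = N m a * y a + N m b * y b :=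
  Fintype.sum_eq_add a b hab fun k hk => h k hk.1 hk.2

namespace Slice

variable {c : Clan p q} {N : Matrix (Fin (p + q)) (Fin (p + q)) ℂ}

theorem mulVec_sign (h : Slice c N) {i : Fin (p + q)} (hi : c.mate i = i)
    {y : Fin (p + q) → ℂ} (hy : ∀ k, (k < i ∨ c.mate k < i) → y k = 0) :
    (N.mulVec y) i = y i := by
  rw [mulVec_eq_single i, h.diag, one_mul]
  intro k hk
  by_cases h1 : k < i ∨ c.mate k < i
  · rw [hy k h1, mul_zero]
  · push Not at h1
    have h2 : c.mate k ≠ i := by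
      intro h2; apply hk; rw [← c.mate_invol k, h2, hi]
    rw [h.above i k (lt_of_le_of_ne h1.1 hk.symm) (lt_of_le_of_ne h1.2 h2.symm), zero_mul]

theorem mulVec_plus (h : Slice c N) {i : Fin (p + q)} (hi : c.IsPlus i)
    (y : Fin (p + q) → ℂ) : (N.mulVec (part c.IsPos y)) i = y i := by
  rw [mulVec_eq_single i, h.diag, one_mul]
  · simp [part, show c.IsPos i from Or.inl hi]
  intro k hk
  by_cases h1 : c.IsPos k
  · rw [h.plus_row i k hi h1 hk, zero_mul]
  · simp [part, h1]

theorem mulVec_minus (h : Slice c N) {i : Fin (p + q)} (hi : c.IsMinus i)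
    (hi' : ¬ c.IsPos i)
    (y : Fin (p + q) → ℂ) : (N.mulVec (part (fun k => ¬ c.IsPos k) y)) i = y i := by
  rw [mulVec_eq_single i, h.diag, one_mul]
  · simp [part, hi']
  intro k hk
  by_cases h1 : c.IsPos k
  · simp [part, h1]
  · rw [h.minus_row i k hi h1 hk, zero_mul]

theorem mulVec_left (h : Slice c N) {i : Fin (p + q)} (hi : i < c.mate i)
    (y : Fin (p + q) → ℂ) : (N.mulVec y) i = y i + y (c.mate i) := by
  rw [mulVec_eq_add i (c.mate i) hi.ne, h.diag, h.left i hi, one_mul, one_mul]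
  intro k hk hk'
  rw [h.left_row i k hi hk hk', zero_mul]

theorem mulVec_right (h : Slice c N) {i : Fin (p + q)} (hi : i < c.mate i)
    {y : Fin (p + q) → ℂ} (hy : ∀ k, (k < i ∨ c.mate k < i) → N (c.mate i) k * y k = 0) :
    (N.mulVec y) (c.mate i) = - y i + y (c.mate i) := by
  rw [mulVec_eq_add i (c.mate i) hi.ne, h.diag, h.right i hi, one_mul, neg_one_mul]
  intro k hk hk'
  by_cases h1 : k < i ∨ c.mate k < i
  · exact hy k h1
  · push Not at h1
    have h2 : c.mate k ≠ i := by
      intro h2; apply hk'; rw [← h2, c.mate_invol]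
    rw [h.right_row i k hi (lt_of_le_of_ne h1.1 hk.symm) (lt_of_le_of_ne h1.2 h2.symm), zero_mul]

end Slice

theorem part_pos {T : Fin (p + q) → Prop} {k : Fin (p + q)} (h : T k) (x : Fin (p + q) → ℂ) :
    part T x k = x k := if_pos h

theorem part_neg {T : Fin (p + q) → Prop} {k : Fin (p + q)} (h : ¬ T k) (x : Fin (p + q) → ℂ) :
    part T x k = 0 := if_neg h

theorem part_eq_zero {T : Fin (p + q) → Prop} {k : Fin (p + q)} {x : Fin (p + q) → ℂ}
    (h : x k = 0) : part T x k = 0 := by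
  simp [part, h]

/-- Induction over the pivot rows of the columns. -/
theorem eq_zero_of_pivot_induction (c : Clan p q) {y : Fin (p + q) → ℂ}
    (h : ∀ i, i ≤ c.mate i → (∀ k, (k < i ∨ c.mate k < i) → y k = 0) →
      y i = 0 ∧ y (c.mate i) = 0) : y = 0 := by
  have main : ∀ i, i ≤ c.mate i → y i = 0 ∧ y (c.mate i) = 0 := by
    intro i
    induction i using WellFoundedLT.induction with
    | ind i ih =>
      intro hi
      refine h i hi fun k hk => ?_
      rcases le_total k (c.mate k) with h1 | h1
      · exact (ih k (by rcases hk with hk | hk <;> omega) h1).1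
      · have := (ih (c.mate k) (by rcases hk with hk | hk <;> omega)
          (by rwa [c.mate_invol])).2
        rwa [c.mate_invol] at this
  funext k
  rcases le_total k (c.mate k) with h1 | h1
  · exact (main k h1).1
  · have := (main (c.mate k) (by rwa [c.mate_invol])).2
    rwa [c.mate_invol] at this

theorem Slice.eq_zero_of_mem_flagKer {c : Clan p q} {N : Matrix (Fin (p + q)) (Fin (p + q)) ℂ}
    (h : Slice c N) {i j : ℕ} (hij : i ≤ j) {x : Fin (p + q) → ℂ} (hx : x ∈ flagKer c N i j)
    (hx0 : ∀ k : Fin (p + q), (k : ℕ) < i → (c.mate k : ℕ) < j → x k = 0) : x = 0 := by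
  refine c.eq_zero_of_pivot_induction fun k hk hy => ?_
  have hneg := mulVec_neg_part hij hx
  rcases hk.lt_or_eq with hk | hk
  · have hp := isPos_of_lt hk
    have hp' := not_isPos_mate hk
    have e1 := h.mulVec_left hk x
    have e2 := h.mulVec_right hk (y := x) (fun k hk => by rw [hy k hk, mul_zero])
    have e3 := h.mulVec_left hk (part c.IsPos x)
    have e4 := h.mulVec_right hk (y := part c.IsPos x)
      (fun k hk => by rw [part_eq_zero (hy k hk), mul_zero])
    have e6 := h.mulVec_right hk (y := part (fun k => ¬ c.IsPos k) x)
      (fun k hk => by rw [part_eq_zero (hy k hk), mul_zero])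
    rw [part_pos hp, part_neg hp'] at e3 e4
    rw [part_neg (not_not.2 hp), part_pos (T := fun k => ¬ c.IsPos k) hp'] at e6
    by_cases hki : (k : ℕ) < i
    · by_cases hkj : (c.mate k : ℕ) < j
      · have hz := hx0 k hki hkj
        refine ⟨hz, ?_⟩
        by_cases hki' : (c.mate k : ℕ) < i
        · exact hx0 _ hki' (by rw [c.mate_invol]; omega)
        · rw [hx.1 _ (by omega), hz] at e2
          simpa using e2.symm
      · rw [hx.2 _ (by omega)] at e4
        rw [hneg _ (by omega)] at e6
        refine ⟨by simpa using e4.symm, by simpa using e6.symm⟩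
    · have hk' : (k : ℕ) < c.mate k := hk
      rw [hx.1 _ (by omega)] at e1 e2
      have : x k = 0 := by linear_combination (e2 - e1) / 2
      refine ⟨this, ?_⟩
      rw [this] at e1
      simpa using e1.symm
  · rw [← hk, and_self]
    by_cases hki : (k : ℕ) < i
    · exact hx0 k hki (by rw [← hk]; omega)
    · rw [← h.mulVec_sign hk.symm hy]
      exact hx.1 _ (by omega)

theorem exists_dual_vector {n : ℕ} (K : Submodule ℂ (Fin n → ℂ)) (H : Finset (Fin n))
    (hinj : ∀ x ∈ K, (∀ k ∈ H, x k = 0) → x = 0) (hc : H.card ≤ Module.finrank ℂ K)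
    {a : Fin n} (ha : a ∈ H) : ∃ x ∈ K, x a = 1 ∧ ∀ k ∈ H, k ≠ a → x k = 0 := by
  let f : K →ₗ[ℂ] (H → ℂ) :=
    (LinearMap.funLeft ℂ ℂ (Subtype.val : H → Fin n)).comp K.subtype
  have hf : Function.Injective f := by
    rw [injective_iff_map_eq_zero]
    intro x hx
    apply Subtype.ext
    exact hinj x x.2 fun k hk => congrFun hx ⟨k, hk⟩
  have hdim : Module.finrank ℂ K = Module.finrank ℂ (H → ℂ) := by
    apply le_antisymm (LinearMap.finrank_le_finrank_of_injective hf)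
    simpa using hc
  obtain ⟨x, hx⟩ := (LinearMap.injective_iff_surjective_of_finrank_eq_finrank hdim).1 hf
    (Pi.single ⟨a, ha⟩ 1)
  refine ⟨x, x.2, ?_, fun k hk hka => ?_⟩
  · exact (congrFun hx ⟨a, ha⟩).trans (Pi.single_eq_same _ _)
  · have := congrFun hx ⟨k, hk⟩
    rw [Pi.single_eq_of_ne (by simpa [Subtype.ext_iff] using hka)] at this
    exact this

/-- The positions `k < i` whose mate lies before `j`. -/
def closedSet (c : Clan p q) (i j : ℕ) : Finset (Fin (p + q)) :=
  Finset.univ.filter fun k : Fin (p + q) => (k : ℕ) < i ∧ (c.mate k : ℕ) < j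

theorem mem_closedSet {c : Clan p q} {i j : ℕ} {k : Fin (p + q)} :
    k ∈ c.closedSet i j ↔ (k : ℕ) < i ∧ (c.mate k : ℕ) < j := by
  simp [closedSet]

namespace Slice

variable {c : Clan p q} {N : Matrix (Fin (p + q)) (Fin (p + q)) ℂ}

theorem exists_dual (h : Slice c N) {i j : ℕ} (hij : i ≤ j)
    (hc : (c.closedSet i j).card ≤ Module.finrank ℂ (flagKer c N i j)) {a : Fin (p + q)}
    (ha : a ∈ c.closedSet i j) :
    ∃ x ∈ flagKer c N i j, x a = 1 ∧ ∀ k ∈ c.closedSet i j, k ≠ a → x k = 0 :=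
  exists_dual_vector _ _ (fun _ hx hx0 => h.eq_zero_of_mem_flagKer hij hx fun k hk hk' =>
    hx0 k (mem_closedSet.2 ⟨hk, hk'⟩)) hc ha

theorem row_sign_eq_zero (h : Slice c N) {a : Fin (p + q)} (ha : c.mate a = a)
    (hc : (c.closedSet a a).card ≤ Module.finrank ℂ (flagKer c N a a)) (k : Fin (p + q))
    (hk : k ≠ a) : N a k = 0 := by
  by_cases hm : k ∈ c.closedSet a a
  swap
  · rw [mem_closedSet] at hm
    have hka : c.mate k ≠ a := by
      intro h2; apply hk; rw [← c.mate_invol k, h2, ha]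
    have hk' : (k : ℕ) ≠ a := fun h => hk (Fin.ext h)
    have hka' : (c.mate k : ℕ) ≠ a := fun h => hka (Fin.ext h)
    rcases lt_or_gt_of_ne hk' with h1 | h1 <;> rcases lt_or_gt_of_ne hka' with h2 | h2
    · exact absurd ⟨h1, h2⟩ hm
    · exact h.between _ _ h1 h2
    · exact h.between' _ _ h2 h1
    · exact h.above _ _ h1 h2
  obtain ⟨x, hx, hx1, hx0⟩ := h.exists_dual le_rfl hc hm
  have key : ∀ l, l ≠ k → l ≠ a → N a l * x l = 0 := by
    intro l hl hla
    by_cases hlm : l ∈ c.closedSet a a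
    · rw [hx0 l hlm hl, mul_zero]
    · rw [mem_closedSet] at hlm
      have hka : c.mate l ≠ a := by
        intro h2; apply hla; rw [← c.mate_invol l, h2, ha]
      have hk' : (l : ℕ) ≠ a := fun h => hla (Fin.ext h)
      have hka' : (c.mate l : ℕ) ≠ a := fun h => hka (Fin.ext h)
      rcases lt_or_gt_of_ne hk' with h1 | h1 <;> rcases lt_or_gt_of_ne hka' with h2 | h2
      · exact absurd ⟨h1, h2⟩ hlm
      · rw [h.between _ _ h1 h2, zero_mul]
      · rw [h.between' _ _ h2 h1, zero_mul]
      · rw [h.above _ _ h1 h2, zero_mul]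
  have key' : ∀ T : Fin (p + q) → Prop, ¬ T a → T k → (N.mulVec (part T x)) a = 0 →
      N a k = 0 := by
    intro T hTa hTk h0
    rw [mulVec_eq_single k, part_pos hTk, hx1, mul_one] at h0
    · exact h0
    · intro l hl
      by_cases hla : l = a
      · subst hla; rw [part_neg hTa, mul_zero]
      · by_cases hTl : T l
        · rw [part_pos hTl, key l hl hla]
        · rw [part_neg hTl, mul_zero]
  rcases c.position_cases a with ⟨-, h1, h2⟩ | ⟨-, h1, h2⟩ | ⟨h1, -⟩ | ⟨h1, -⟩
  · by_cases hkp : c.IsPos k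
    · exact h.plus_row a k h1 hkp hk
    · exact key' (fun k => ¬ c.IsPos k) (not_not.2 h2) hkp (mulVec_neg_part le_rfl hx a le_rfl)
  · by_cases hkp : c.IsPos k
    · exact key' c.IsPos h2 hkp (hx.2 a le_rfl)
    · exact h.minus_row a k h1 hkp hk
  · exact absurd ha h1.ne'
  · exact absurd ha h1.ne

theorem row_right_eq_zero_of_cross (h : Slice c N) {a : Fin (p + q)} (ha : a < c.mate a)
    (hc : (c.closedSet a (c.mate a)).card ≤ Module.finrank ℂ (flagKer c N a (c.mate a)))
    {s : Fin (p + q)} (hs : s < a) (hsa : a < c.mate s) (hsb : c.mate s < c.mate a) :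
    N (c.mate a) s = 0 := by
  have hab : (a : ℕ) < c.mate a := ha
  have hm : s ∈ c.closedSet a (c.mate a) := mem_closedSet.2 ⟨hs, hsb⟩
  obtain ⟨x, hx, hx1, hx0⟩ := h.exists_dual hab.le hc hm
  have hss : s < c.mate s := hs.trans hsa
  set y : Fin (p + q) → ℂ := x - Pi.single s 1 - Pi.single (c.mate s) 1 with hy
  have hys : y s = 0 := by
    simp [hy, hx1, Pi.single_eq_of_ne hss.ne]
  have hyH : ∀ k : Fin (p + q), k < a → c.mate k < c.mate a → y k = 0 := by
    intro k hk hk'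
    by_cases hks : k = s
    · rw [hks, hys]
    · have : k ≠ c.mate s := (hk.trans hsa).ne
      simp [hy, hx0 k (mem_closedSet.2 ⟨hk, hk'⟩) hks, hks, this]
  have hyx : ∀ k, k ≠ s → k ≠ c.mate s → x k = y k := by
    intro k h1 h2
    simp [hy, h1, h2]
  have hN : ∀ m, (N.mulVec y) m = (N.mulVec x) m - N m s - N m (c.mate s) := by
    intro m
    simp [hy, Matrix.mulVec_sub]
  have claim : ∀ t : Fin (p + q), t < a → a < c.mate t → c.mate t < c.mate a →
      y (c.mate t) = 0 := by
    intro t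
    induction t using WellFoundedLT.induction with
    | ind t ih =>
      intro hta hta' htb
      have htt := hta.trans hta'
      have e := h.mulVec_right htt (y := y) (by
        intro k hk
        by_cases hka : k < a
        · rcases lt_trichotomy (c.mate k) (c.mate a) with h1 | h1 | h1
          · rw [hyH k hka h1, mul_zero]
          · exfalso
            have := congrArg c.mate h1
            rw [c.mate_invol, c.mate_invol] at this
            omega
          · rw [h.between _ _ (by omega) (by omega), zero_mul]
        · have h1 : c.mate k < t := by omega
          by_cases h2 : k < c.mate t
          · have := ih (c.mate k) h1 (by omega) (by
              rw [c.mate_invol]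
              refine lt_of_le_of_ne (by omega) ?_
              rintro rfl
              omega) (by rw [c.mate_invol]; omega)
            rw [c.mate_invol] at this
            rw [this, mul_zero]
          · rcases (not_lt.1 h2).eq_or_lt with h3 | h3
            · rw [← h3, c.mate_invol] at h1
              omega
            · rw [h.between' _ _ (by omega) h3, zero_mul])
      rw [hyH t hta htb, neg_zero, zero_add] at e
      rw [← e, hN, hx.1 (c.mate t) (by have : a < c.mate t := hta'; exact this.le)]
      rcases lt_trichotomy t s with h1 | h1 | h1
      · rw [h.right_row t s htt h1 (by omega), h.right_row t (c.mate s) htt (by omega)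
          (by rw [c.mate_invol]; omega)]
        simp
      · rw [h1, h.right s hss, h.diag]
        simp
      · rcases lt_trichotomy (c.mate s) (c.mate t) with h2 | h2 | h2
        · rw [h.cross s t h1 (by omega) h2]
          simp
        · have := congrArg c.mate h2
          rw [c.mate_invol, c.mate_invol] at this
          omega
        · rw [h.between _ _ (by omega) h2, h.between' _ (c.mate s)
            (by rw [c.mate_invol]; omega) h2]
          simp
  have ep : (N.mulVec (part c.IsPos x)) (c.mate a) = - x a + N (c.mate a) s := by
    rw [mulVec_eq_add a s hs.ne', part_pos (isPos_of_lt ha), part_pos (isPos_of_lt hss),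
      h.right a ha, hx1]
    · ring
    intro k hka hks
    by_cases hkp : c.IsPos k
    · have hkk : k ≤ c.mate k := by
        by_contra hcon
        exact not_isPos_of_lt (not_le.1 hcon) hkp
      rcases lt_trichotomy k a with h1 | h1 | h1
      · rcases lt_trichotomy (c.mate k) (c.mate a) with h2 | h2 | h2
        · rw [part_eq_zero (hx0 k (mem_closedSet.2 ⟨h1, h2⟩) hks), mul_zero]
        · have := congrArg c.mate h2
          rw [c.mate_invol, c.mate_invol] at this
          omega
        · rw [h.between _ _ (by omega) h2, zero_mul]
      · exact absurd h1 hka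
      · rw [h.right_row a k ha h1 (by omega), zero_mul]
    · rw [part_neg hkp, mul_zero]
  have em : (N.mulVec (part (fun k => ¬ c.IsPos k) x)) (c.mate a) =
      x (c.mate a) + N (c.mate a) (c.mate s) := by
    have hxt : x (c.mate s) = 1 := by
      have := claim s hs hsa hsb
      simp only [hy, Pi.sub_apply, Pi.single_eq_same, Pi.single_eq_of_ne hss.ne', sub_zero] at this
      linear_combination this
    rw [mulVec_eq_add (c.mate a) (c.mate s) hsb.ne',
      part_pos (T := fun k => ¬ c.IsPos k) (not_isPos_mate ha),
      part_pos (T := fun k => ¬ c.IsPos k) (not_isPos_mate hss), h.diag, hxt]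
    · ring
    intro k hkb hkt
    by_cases hkp : c.IsPos k
    · rw [part_neg (not_not.2 hkp), mul_zero]
    · have hks : k ≠ s := fun h => hkp (h ▸ isPos_of_lt hss)
      have hka : k ≠ a := fun h => hkp (h ▸ isPos_of_lt ha)
      have hma : c.mate k ≠ a := by
        intro h1; apply hkb; rw [← h1, c.mate_invol]
      have hmb : c.mate k ≠ c.mate a := by
        intro h1; apply hka; rw [← c.mate_invol a, ← h1, c.mate_invol]
      have hkk : c.mate k ≤ k := by
        by_contra hcon
        exact hkp (isPos_of_lt (not_le.1 hcon))
      by_cases h1 : a < c.mate k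
      · rw [h.right_row a k ha (by omega) h1, zero_mul]
      · have h1 : c.mate k < a := by omega
        by_cases h2 : k < a
        · rw [part_eq_zero (hx0 k (mem_closedSet.2 ⟨h2, by
            have : c.mate k < c.mate a := by omega
            exact this⟩) hks), mul_zero]
        · by_cases h3 : k < c.mate a
          · have := claim (c.mate k) h1 (by rw [c.mate_invol]; omega) (by rwa [c.mate_invol])
            rw [c.mate_invol, ← hyx k hks hkt] at this
            rw [part_eq_zero this, mul_zero]
          · rw [h.between' _ _ (by omega) (by omega), zero_mul]
  have ea := h.mulVec_left ha x
  rw [hx.1 a le_rfl] at ea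
  rw [hx.2 _ le_rfl] at ep
  rw [mulVec_neg_part hab.le hx _ le_rfl, h.cross s a hs hsa hsb] at em
  linear_combination (em - ea - ep) / 2

end Slice

namespace Slice

variable {c : Clan p q} {N : Matrix (Fin (p + q)) (Fin (p + q)) ℂ}

theorem row_right_eq_zero (h : Slice c N) {a : Fin (p + q)} (ha : a < c.mate a)
    (hc : (c.closedSet a (c.mate a)).card ≤ Module.finrank ℂ (flagKer c N a (c.mate a)))
    (k : Fin (p + q)) (hka : k ≠ a) (hkb : k ≠ c.mate a) : N (c.mate a) k = 0 := by
  have hab : (a : ℕ) < c.mate a := ha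
  have hma : ∀ {k}, k ≠ c.mate a → c.mate k ≠ a := by
    intro k hkb h1; apply hkb; rw [← h1, c.mate_invol]
  have hmb : ∀ {k}, k ≠ a → c.mate k ≠ c.mate a := by
    intro k hka h1; apply hka; rw [← c.mate_invol a, ← h1, c.mate_invol]
  have cross0 : ∀ s : Fin (p + q), s < a → a < c.mate s → c.mate s < c.mate a →
      N (c.mate a) s = 0 ∧ N (c.mate a) (c.mate s) = 0 := by
    intro s hs hsa hsb
    have := h.row_right_eq_zero_of_cross ha hc hs hsa hsb
    exact ⟨this, by rw [h.cross s a hs hsa hsb, this, neg_zero]⟩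
  have other : ∀ k, k ≠ a → k ≠ c.mate a →
      (k ∈ c.closedSet a (c.mate a) ∧ c.mate k < a) ∨ N (c.mate a) k = 0 := by
    intro k hka hkb
    have h1 := hma hkb
    have h2 := hmb hka
    rcases lt_or_gt_of_ne hka with h3 | h3
    · rcases lt_or_gt_of_ne h2 with h4 | h4
      · rcases lt_or_gt_of_ne h1 with h5 | h5
        · exact Or.inl ⟨mem_closedSet.2 ⟨h3, h4⟩, h5⟩
        · exact Or.inr (cross0 k h3 h5 h4).1
      · exact Or.inr (h.between _ _ (by omega) h4)
    · rcases lt_or_gt_of_ne h1 with h4 | h4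
      · rcases lt_or_gt_of_ne hkb with h5 | h5
        · have := (cross0 (c.mate k) h4 (by rwa [c.mate_invol]) (by rwa [c.mate_invol])).2
          rw [c.mate_invol] at this
          exact Or.inr this
        · exact Or.inr (h.between' _ _ (by omega) h5)
      · exact Or.inr (h.right_row a k ha h3 h4)
  rcases other k hka hkb with ⟨hm, -⟩ | h0
  swap
  · exact h0
  obtain ⟨x, hx, hx1, hx0⟩ := h.exists_dual hab.le hc hm
  have key : ∀ l, l ≠ a → l ≠ c.mate a → l ≠ k → N (c.mate a) l * x l = 0 := by
    intro l h1 h2 h3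
    rcases other l h1 h2 with ⟨h4, -⟩ | h4
    · rw [hx0 l h4 h3, mul_zero]
    · rw [h4, zero_mul]
  have ep : (N.mulVec (part c.IsPos x)) (c.mate a) =
      - x a + N (c.mate a) k * part c.IsPos x k := by
    rw [mulVec_eq_add a k hka.symm, part_pos (isPos_of_lt ha), h.right a ha]
    · ring
    intro l hla hlk
    by_cases hlb : l = c.mate a
    · rw [hlb, part_neg (not_isPos_mate ha), mul_zero]
    · by_cases hl : c.IsPos l
      · rw [part_pos hl, key l hla hlb hlk]
      · rw [part_neg hl, mul_zero]
  have em : (N.mulVec (part (fun k => ¬ c.IsPos k) x)) (c.mate a) =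
      x (c.mate a) + N (c.mate a) k * part (fun k => ¬ c.IsPos k) x k := by
    rw [mulVec_eq_add (c.mate a) k hkb.symm,
      part_pos (T := fun k => ¬ c.IsPos k) (not_isPos_mate ha), h.diag]
    · ring
    intro l hlb hlk
    by_cases hla : l = a
    · rw [hla, part_neg (not_not.2 (isPos_of_lt ha)), mul_zero]
    · by_cases hl : c.IsPos l
      · rw [part_neg (not_not.2 hl), mul_zero]
      · rw [part_pos (T := fun k => ¬ c.IsPos k) hl, key l hla hlb hlk]
  have ea := h.mulVec_left ha x
  rw [hx.1 a le_rfl] at ea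
  rw [hx.2 _ le_rfl] at ep
  rw [mulVec_neg_part hab.le hx _ le_rfl] at em
  by_cases hk : c.IsPos k
  · rw [part_pos hk, hx1] at ep
    rw [part_neg (not_not.2 hk)] at em
    linear_combination em - ea - ep
  · rw [part_neg hk] at ep
    rw [part_pos (T := fun k => ¬ c.IsPos k) hk, hx1] at em
    linear_combination ep + ea - em

theorem mulVec_part_single (N : Matrix (Fin (p + q)) (Fin (p + q)) ℂ) (T : Fin (p + q) → Prop)
    (a m : Fin (p + q)) : (N.mulVec (part T (Pi.single a 1))) m = if T a then N m a else 0 := by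
  rw [mulVec_eq_single a]
  · simp [part]
  · intro k hk
    simp [part, hk]

theorem part_sub (T : Fin (p + q) → Prop) (x y : Fin (p + q) → ℂ) :
    part T (x - y) = part T x - part T y := by
  funext k
  by_cases h : T k <;> simp [part, h]

theorem column_sign_eq_zero (h : Slice c N) {a : Fin (p + q)} (ha : c.mate a = a)
    (hc : (c.closedSet (a + 1) (a + 1)).card ≤
      Module.finrank ℂ (flagKer c N (a + 1) (a + 1))) (m : Fin (p + q))
    (hm : m ≠ a) : N m a = 0 := by
  obtain ⟨x, hx, hx1, hx0⟩ := h.exists_dual le_rfl hc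
    (mem_closedSet.2 ⟨Nat.lt_succ_self _, by rw [ha]; exact Nat.lt_succ_self _⟩)
  have hxn := mulVec_neg_part le_rfl hx
  obtain ⟨y, hy⟩ : ∃ y, y = x - Pi.single a 1 := ⟨_, rfl⟩
  have hyT : ∀ T m, (N.mulVec (part T y)) m =
      (N.mulVec (part T x)) m - if T a then N m a else 0 := by
    intro T m
    rw [hy, part_sub, Matrix.mulVec_sub, Pi.sub_apply, mulVec_part_single]
  have hyp : ∀ m : Fin (p + q), a < m → N m a = 0 → (N.mulVec (part c.IsPos y)) m = 0 := by
    intro m hm h0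
    rw [hyT, hx.2 m hm, h0]; simp
  have hyn : ∀ m : Fin (p + q), a < m → N m a = 0 →
      (N.mulVec (part (fun k => ¬ c.IsPos k) y)) m = 0 := by
    intro m hm h0
    rw [hyT, hxn m hm, h0]; simp
  have hya : y a = 0 := by simp [hy, hx1]
  have hyH : ∀ k, k < a → c.mate k < a → y k = 0 := by
    intro k hk hk'
    rw [hy, Pi.sub_apply, hx0 k (mem_closedSet.2 ⟨Nat.lt_succ_of_lt hk, Nat.lt_succ_of_lt hk'⟩)
      hk.ne, Pi.single_eq_of_ne hk.ne, sub_zero]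
  have hy0 : y = 0 := by
    refine c.eq_zero_of_pivot_induction fun i hi hi0 => ?_
    rcases lt_trichotomy i a with h1 | h1 | h1
    · have hia : c.mate i ≠ a := by
        intro h2; apply h1.ne; rw [← c.mate_invol i, h2, ha]
      rcases lt_or_gt_of_ne hia with h2 | h2
      · exact ⟨hyH i h1 h2, hyH _ h2 (by rwa [c.mate_invol])⟩
      · have hii := h1.trans h2
        have e1 := h.mulVec_right hii (y := part c.IsPos y)
          (fun k hk => by rw [part_eq_zero (hi0 k hk), mul_zero])
        have e2 := h.mulVec_right hii (y := part (fun k => ¬ c.IsPos k) y)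
          (fun k hk => by rw [part_eq_zero (hi0 k hk), mul_zero])
        have h0 := h.right_row i a hii h1 (by rwa [ha])
        rw [hyp _ h2 h0, part_pos (isPos_of_lt hii), part_neg (not_isPos_mate hii)] at e1
        rw [hyn _ h2 h0, part_neg (not_not.2 (isPos_of_lt hii)),
          part_pos (T := fun k => ¬ c.IsPos k) (not_isPos_mate hii)] at e2
        exact ⟨by simpa using e1.symm, by simpa using e2.symm⟩
    · rw [h1, ha, and_self]; exact hya
    · rcases c.position_cases i with ⟨h2, h3, h4⟩ | ⟨h2, h3, h4⟩ | ⟨h2, h4⟩ | ⟨h2, -⟩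
      · rw [h2, and_self, ← h.mulVec_plus h3 y, hyT, hx.2 i h1, zero_sub, neg_eq_zero]
        split_ifs with h5
        · exact h.plus_row i a h3 h5 h1.ne
        · rfl
      · rw [h2, and_self, ← h.mulVec_minus h3 h4 y, hyT, hxn i h1, zero_sub, neg_eq_zero]
        split_ifs with h5
        · rfl
        · exact h.minus_row i a h3 h5 h1.ne
      · have h0 := h.left_row i a h2 h1.ne (h1.trans h2).ne
        have e1 := h.mulVec_left h2 (part c.IsPos y)
        have e2 := h.mulVec_left h2 (part (fun k => ¬ c.IsPos k) y)
        rw [hyp _ h1 h0, part_pos (isPos_of_lt h2), part_neg (not_isPos_mate h2)] at e1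
        rw [hyn _ h1 h0, part_neg (not_not.2 (isPos_of_lt h2)),
          part_pos (T := fun k => ¬ c.IsPos k) (not_isPos_mate h2)] at e2
        exact ⟨by simpa using e1.symm, by simpa using e2.symm⟩
      · exact absurd hi (not_le.2 h2)
  rcases lt_or_gt_of_ne hm with h1 | h1
  · exact h.above m a h1 (by rwa [ha])
  · have e : (N.mulVec (part (fun _ => True) y)) m = 0 := by
      have : part (fun _ => True) y = 0 := by rw [hy0]; funext k; simp [part]
      rw [this, Matrix.mulVec_zero]; rfl
    have hx' : part (fun _ => True) x = x := by funext k; simp [part]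
    rw [hyT, hx', hx.1 m h1] at e
    simpa using e

theorem column_left_eq_zero (h : Slice c N) {a : Fin (p + q)} (ha : a < c.mate a)
    (hc : (c.closedSet (a + 1) (c.mate a + 1)).card ≤
      Module.finrank ℂ (flagKer c N (a + 1) (c.mate a + 1))) (m : Fin (p + q))
    (hma : m ≠ a) (hmb : m ≠ c.mate a) : N m a = 0 ∧ N m (c.mate a) = 0 := by
  have hab : (a : ℕ) < c.mate a := ha
  have hij : (a : ℕ) + 1 ≤ (c.mate a : ℕ) + 1 := by omega
  obtain ⟨x, hx, hx1, hx0⟩ := h.exists_dual hij hc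
    (mem_closedSet.2 ⟨Nat.lt_succ_self _, Nat.lt_succ_self _⟩)
  have hxn := mulVec_neg_part hij hx
  obtain ⟨y, hy⟩ : ∃ y, y = x - Pi.single a 1 - Pi.single (c.mate a) 1 := ⟨_, rfl⟩
  have hyT : ∀ T m, (N.mulVec (part T y)) m = (N.mulVec (part T x)) m -
      (if T a then N m a else 0) - if T (c.mate a) then N m (c.mate a) else 0 := by
    intro T m
    rw [hy, part_sub, part_sub, Matrix.mulVec_sub, Matrix.mulVec_sub, Pi.sub_apply, Pi.sub_apply,
      mulVec_part_single, mulVec_part_single]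
  have hyp : ∀ m : Fin (p + q), c.mate a < m →
      (N.mulVec (part c.IsPos y)) m = - N m a := by
    intro m hm
    rw [hyT, hx.2 m (by omega), if_pos (isPos_of_lt ha), if_neg (not_isPos_mate ha)]; ring
  have hyn : ∀ m : Fin (p + q), c.mate a < m →
      (N.mulVec (part (fun k => ¬ c.IsPos k) y)) m = - N m (c.mate a) := by
    intro m hm
    rw [hyT, hxn m (by omega), if_neg (not_not.2 (isPos_of_lt ha)), if_pos (not_isPos_mate ha)]
    ring
  have hyf : ∀ m : Fin (p + q), a < m →
      (N.mulVec y) m = - N m a - N m (c.mate a) := by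
    intro m hm
    have := hyT (fun _ => True) m
    have h1 : ∀ z, part (fun _ : Fin (p + q) => True) z = z := by intro z; funext k; simp [part]
    rw [h1, h1, hx.1 m (by omega)] at this
    rw [this]; simp
  have hya : y a = 0 := by simp [hy, hx1, Pi.single_eq_of_ne ha.ne]
  have hyH : ∀ k, k < a → c.mate k < c.mate a → y k = 0 := by
    intro k hk hk'
    rw [hy, Pi.sub_apply, Pi.sub_apply, hx0 k (mem_closedSet.2 ⟨by omega, by omega⟩)
      hk.ne, Pi.single_eq_of_ne hk.ne, Pi.single_eq_of_ne (hk.trans ha).ne]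
    simp
  have hy0 : y = 0 := by
    refine c.eq_zero_of_pivot_induction fun i hi hi0 => ?_
    have hi0' : ∀ k, (k < i ∨ c.mate k < i) → N (c.mate i) k * y k = 0 :=
      fun k hk => by rw [hi0 k hk, mul_zero]
    have hi1 : ∀ T k, (k < i ∨ c.mate k < i) → N (c.mate i) k * part T y k = 0 :=
      fun T k hk => by rw [part_eq_zero (hi0 k hk), mul_zero]
    rcases lt_trichotomy i a with h1 | h1 | h1
    · have hia : c.mate i ≠ a := by
        intro h2
        have := congrArg c.mate h2
        rw [c.mate_invol] at this
        omega
      have hib : c.mate i ≠ c.mate a := by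
        intro h2
        have := congrArg c.mate h2
        rw [c.mate_invol, c.mate_invol] at this
        omega
      rcases lt_or_gt_of_ne hib with h2 | h2
      · refine ⟨hyH i h1 h2, ?_⟩
        rcases lt_or_gt_of_ne hia with h3 | h3
        · exact hyH _ h3 (by rw [c.mate_invol]; exact h1.trans ha)
        · have hii := h1.trans h3
          have e := h.mulVec_right hii hi0'
          rw [hyf _ h3, hyH i h1 h2, h.right_row i a hii h1 (h1.trans ha),
            h.right_row i (c.mate a) hii (h1.trans ha) (by rwa [c.mate_invol])] at e
          simpa using e.symm
      · have hii : i < c.mate i := by omega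
        have e1 := h.mulVec_right hii (hi1 c.IsPos)
        have e2 := h.mulVec_right hii (hi1 fun k => ¬ c.IsPos k)
        rw [hyp _ h2, h.right_row i a hii h1 (h1.trans ha), part_pos (isPos_of_lt hii),
          part_neg (not_isPos_mate hii)] at e1
        rw [hyn _ h2, h.right_row i (c.mate a) hii (h1.trans ha) (by rwa [c.mate_invol]),
          part_neg (not_not.2 (isPos_of_lt hii)),
          part_pos (T := fun k => ¬ c.IsPos k) (not_isPos_mate hii)] at e2
        exact ⟨by simpa using e1.symm, by simpa using e2.symm⟩
    · subst h1
      refine ⟨hya, ?_⟩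
      have e := h.mulVec_right ha hi0'
      rw [hyf _ ha, hya, h.right i ha, h.diag] at e
      simpa using e.symm
    · have hib : i ≠ c.mate a := by
        rintro rfl
        rw [c.mate_invol] at hi
        omega
      have hmi : c.mate i ≠ c.mate a := by
        intro h2
        have := congrArg c.mate h2
        rw [c.mate_invol, c.mate_invol] at this
        omega
      rcases c.position_cases i with ⟨h2, h3, h4⟩ | ⟨h2, h3, h4⟩ | ⟨h2, h4⟩ | ⟨h2, -⟩
      · rw [h2, and_self]
        rcases lt_or_gt_of_ne hib with h5 | h5
        · rw [← h.mulVec_sign h2 hi0, hyf i h1, h.between i a h1 h5,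
            h.between' i (c.mate a) (by rwa [c.mate_invol]) h5]
          simp
        · rw [← h.mulVec_plus h3 y, hyp i h5, h.plus_row i a h3 (isPos_of_lt ha) h1.ne, neg_zero]
      · rw [h2, and_self]
        rcases lt_or_gt_of_ne hib with h5 | h5
        · rw [← h.mulVec_sign h2 hi0, hyf i h1, h.between i a h1 h5,
            h.between' i (c.mate a) (by rwa [c.mate_invol]) h5]
          simp
        · rw [← h.mulVec_minus h3 h4 y, hyn i h5,
            h.minus_row i (c.mate a) h3 (not_isPos_mate ha) h5.ne, neg_zero]
      · have hz1 := h.left_row i a h2 h1.ne (h1.trans h2).ne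
        have hz2 := h.left_row i (c.mate a) h2 hib.symm hmi.symm
        have hip := isPos_of_lt h2
        have him := not_isPos_mate h2
        rcases lt_or_gt_of_ne hib with h5 | h5
        · have e := h.mulVec_left h2 y
          rw [hyf i h1, hz1, hz2] at e
          suffices hs : y i = y (c.mate i) by
            rw [← hs] at e ⊢
            have : y i = 0 := by linear_combination - e / 2
            exact ⟨this, this⟩
          rcases lt_or_gt_of_ne hmi with h6 | h6
          · have e' := h.mulVec_right h2 hi0'
            rw [hyf _ (h1.trans h2), h.between _ a (h1.trans h2) h6,
              h.between' _ (c.mate a) (by rw [c.mate_invol]; exact h1.trans h2) h6] at e'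
            linear_combination e'
          · have e1 := h.mulVec_right h2 (hi1 c.IsPos)
            have e2 := h.mulVec_right h2 (hi1 fun k => ¬ c.IsPos k)
            rw [hyp _ h6, part_pos hip, part_neg him] at e1
            rw [hyn _ h6, part_neg (not_not.2 hip),
              part_pos (T := fun k => ¬ c.IsPos k) him, h.cross a i h1 h5 h6] at e2
            linear_combination e1 + e2
        · have e1 := h.mulVec_left h2 (part c.IsPos y)
          have e2 := h.mulVec_left h2 (part (fun k => ¬ c.IsPos k) y)
          rw [hyp _ h5, hz1, part_pos hip, part_neg him] at e1
          rw [hyn _ h5, hz2, part_neg (not_not.2 hip),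
            part_pos (T := fun k => ¬ c.IsPos k) him] at e2
          exact ⟨by simpa using e1.symm, by simpa using e2.symm⟩
      · exact absurd hi (not_le.2 h2)
  rcases lt_or_gt_of_ne hma with h1 | h1
  · exact ⟨h.above m a h1 (h1.trans ha), h.above m (c.mate a) (h1.trans ha)
      (by rwa [c.mate_invol])⟩
  rcases lt_or_gt_of_ne hmb with h2 | h2
  · exact ⟨h.between m a h1 h2, h.between' m (c.mate a) (by rwa [c.mate_invol]) h2⟩
  · have e : ∀ T, (N.mulVec (part T y)) m = 0 := by
      intro T
      have : part T y = 0 := by rw [hy0]; funext k; simp [part]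
      rw [this, Matrix.mulVec_zero]; rfl
    have e1 := e c.IsPos
    have e2 := e fun k => ¬ c.IsPos k
    rw [hyp m h2] at e1
    rw [hyn m h2] at e2
    exact ⟨neg_eq_zero.1 e1, neg_eq_zero.1 e2⟩

end Slice

theorem card_filter_le_of_sum_le {n : ℕ} (f g : Fin n → Prop) [DecidablePred f] [DecidablePred g]
    (S : Finset (Fin n)) (h : ∀ k ∉ S, f k → g k)
    (hS : ∑ k ∈ S, (if f k then 1 else 0) ≤ ∑ k ∈ S, (if g k then 1 else 0)) :
    (Finset.univ.filter f).card ≤ (Finset.univ.filter g).card := by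
  rw [Finset.card_filter, Finset.card_filter, ← Finset.sum_add_sum_compl S,
    ← Finset.sum_add_sum_compl S (fun k => if g k then 1 else 0)]
  refine add_le_add hS (Finset.sum_le_sum fun k hk => ?_)
  have := h k (Finset.mem_compl.1 hk)
  split_ifs <;> simp_all

/-- The number of positions `k < i` whose mate is not before `j`. -/
def openCard (c : Clan p q) (i j : ℕ) : ℕ :=
  (Finset.univ.filter fun k : Fin (p + q) => (k : ℕ) < i ∧ j ≤ (c.mate k : ℕ)).card

theorem Transposition.openCard_le {c c' : Clan p q} (h : Transposition c c') {i j : ℕ}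
    (hij : i ≤ j) : c.openCard i j ≤ c'.openCard i j := by
  have two : ∀ a b : Fin (p + q), a ≠ b → AgreeOutside c c' {a, b} →
      ((if (a : ℕ) < i ∧ j ≤ (c.mate a : ℕ) then 1 else 0) +
        (if (b : ℕ) < i ∧ j ≤ (c.mate b : ℕ) then 1 else 0) ≤
      (if (a : ℕ) < i ∧ j ≤ (c'.mate a : ℕ) then 1 else 0) +
        (if (b : ℕ) < i ∧ j ≤ (c'.mate b : ℕ) then 1 else 0)) →
      c.openCard i j ≤ c'.openCard i j := by
    intro a b hab hag hle
    unfold openCard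
    refine card_filter_le_of_sum_le _ _ {a, b} (fun k hk => ?_) ?_
    · rw [(hag k (by simpa using hk)).1]; exact id
    · rw [Finset.sum_pair hab, Finset.sum_pair hab]; exact hle
  have three : ∀ a b d : Fin (p + q), a ≠ b → a ≠ d → b ≠ d → AgreeOutside c c' {a, b, d} →
      ((if (a : ℕ) < i ∧ j ≤ (c.mate a : ℕ) then 1 else 0) +
        ((if (b : ℕ) < i ∧ j ≤ (c.mate b : ℕ) then 1 else 0) +
        (if (d : ℕ) < i ∧ j ≤ (c.mate d : ℕ) then 1 else 0)) ≤
      (if (a : ℕ) < i ∧ j ≤ (c'.mate a : ℕ) then 1 else 0) +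
        ((if (b : ℕ) < i ∧ j ≤ (c'.mate b : ℕ) then 1 else 0) +
        (if (d : ℕ) < i ∧ j ≤ (c'.mate d : ℕ) then 1 else 0))) →
      c.openCard i j ≤ c'.openCard i j := by
    intro a b d hab had hbd hag hle
    unfold openCard
    refine card_filter_le_of_sum_le _ _ {a, b, d} (fun k hk => ?_) ?_
    · rw [(hag k (by simpa using hk)).1]; exact id
    · have ha : a ∉ ({b, d} : Finset (Fin (p + q))) := by simp [hab, had]
      rw [Finset.sum_insert ha, Finset.sum_insert ha,
        Finset.sum_pair hbd, Finset.sum_pair hbd]; exact hle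
  have four : ∀ a b d e : Fin (p + q), a < b → b < d → d < e →
      AgreeOutside c c' {a, b, d, e} →
      ((if (a : ℕ) < i ∧ j ≤ (c.mate a : ℕ) then 1 else 0) +
        ((if (b : ℕ) < i ∧ j ≤ (c.mate b : ℕ) then 1 else 0) +
        ((if (d : ℕ) < i ∧ j ≤ (c.mate d : ℕ) then 1 else 0) +
        (if (e : ℕ) < i ∧ j ≤ (c.mate e : ℕ) then 1 else 0))) ≤
      (if (a : ℕ) < i ∧ j ≤ (c'.mate a : ℕ) then 1 else 0) +
        ((if (b : ℕ) < i ∧ j ≤ (c'.mate b : ℕ) then 1 else 0) +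
        ((if (d : ℕ) < i ∧ j ≤ (c'.mate d : ℕ) then 1 else 0) +
        (if (e : ℕ) < i ∧ j ≤ (c'.mate e : ℕ) then 1 else 0)))) →
      c.openCard i j ≤ c'.openCard i j := by
    intro a b d e hab hbd hde hag hle
    have hb : b ∉ ({d, e} : Finset (Fin (p + q))) := by
      simp [hbd.ne, (hbd.trans hde).ne]
    have ha : a ∉ ({b, d, e} : Finset (Fin (p + q))) := by
      simp [hab.ne, (hab.trans hbd).ne, (hab.trans (hbd.trans hde)).ne]
    unfold openCard
    refine card_filter_le_of_sum_le _ _ {a, b, d, e} (fun k hk => ?_) ?_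
    · rw [(hag k (by simpa using hk)).1]; exact id
    · rw [Finset.sum_insert ha, Finset.sum_insert ha, Finset.sum_insert hb,
        Finset.sum_insert hb, Finset.sum_pair hde.ne, Finset.sum_pair hde.ne]; exact hle
  have back : ∀ {c : Clan p q} {a b}, c.IsMatch a b → c.mate b = a := by
    rintro c a b ⟨-, rfl⟩
    exact c.mate_invol a
  have drop : ∀ a b : Fin (p + q), a ≤ b →
      (if (b : ℕ) < i ∧ j ≤ (a : ℕ) then 1 else 0) = 0 := by
    intro a b hab
    exact if_neg fun h => by omega
  rcases h with ⟨a, b, hab, h1, h2, h3, hag⟩ | ⟨a, b, hab, h1, h2, h3, hag⟩ |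
    ⟨a, b, d, h1, hbd, h2, h3, h4, hag⟩ | ⟨a, b, d, h1, hbd, h2, h3, h4, hag⟩ |
    ⟨a, b, d, h1, hab, h2, h3, h4, hag⟩ | ⟨a, b, d, h1, hab, h2, h3, h4, hag⟩ |
    ⟨a, b, d, e, h1, hbd, h2, h3, h4, hag⟩ | ⟨a, b, d, e, h1, hbd, h2, h3, h4, h5, hag⟩ |
    ⟨a, b, d, e, h1, hbd, h2, h3, h4, h5, hag⟩ |
    ⟨a, b, d, e, hab, hbd, hde, h1, h2, h3, h4, hag⟩
  · refine two a b hab.ne hag ?_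
    rw [h1.1, h2.1, h3.2, back h3]
    split_ifs <;> omega
  · refine two a b hab.ne hag ?_
    rw [h1.1, h2.1, h3.2, back h3]
    split_ifs <;> omega
  · refine three a b d h1.1.ne (h1.1.trans hbd).ne hbd.ne hag ?_
    rw [h1.2, back h1, h2.1, h3.2, back h3, h4.1]
    have := h1.1
    split_ifs <;> omega
  · refine three a b d h1.1.ne (h1.1.trans hbd).ne hbd.ne hag ?_
    rw [h1.2, back h1, h2.1, h3.2, back h3, h4.1]
    have := h1.1
    split_ifs <;> omega
  · refine three a b d hab.ne (hab.trans h2.1).ne h2.1.ne hag ?_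
    rw [h2.2, back h2, h1.1, h3.2, back h3, h4.1]
    have := h2.1
    split_ifs <;> omega
  · refine three a b d hab.ne (hab.trans h2.1).ne h2.1.ne hag ?_
    rw [h2.2, back h2, h1.1, h3.2, back h3, h4.1]
    have := h2.1
    split_ifs <;> omega
  · have hab := h1.1
    have hde := h2.1
    refine four a b d e hab hbd hde hag ?_
    rw [h1.2, h2.2, back h1, back h2, h3.2, h4.2, back h3, back h4,
      drop a b hab.le, drop d e hde.le, drop a d (hab.trans hbd).le, drop b e (hbd.trans hde).le]
    split_ifs <;> omega
  · have hab := h1.1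
    have hde := h2.1
    refine four a b d e hab hbd hde hag ?_
    rw [h1.2, h2.2, back h1, back h2, h3.2, back h3, h4.1, h5.1,
      drop a b hab.le, drop d e hde.le, drop a e (hab.trans (hbd.trans hde)).le,
      drop b b le_rfl, drop d d le_rfl]
    split_ifs <;> omega
  · have hab := h1.1
    have hde := h2.1
    refine four a b d e hab hbd hde hag ?_
    rw [h1.2, h2.2, back h1, back h2, h3.2, back h3, h4.1, h5.1,
      drop a b hab.le, drop d e hde.le, drop a e (hab.trans (hbd.trans hde)).le,
      drop b b le_rfl, drop d d le_rfl]
    split_ifs <;> omega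
  · refine four a b d e hab hbd hde hag ?_
    rw [h1.2, h2.2, back h1, back h2, h3.2, back h3, h4.2, back h4,
      drop a d (hab.trans hbd).le, drop b e (hbd.trans hde).le,
      drop a e (hab.trans (hbd.trans hde)).le, drop b d hbd.le]
    split_ifs <;> omega

theorem ble.openCard_le {c c' : Clan p q} (h : ble c c') {i j : ℕ} (hij : i ≤ j) :
    c.openCard i j ≤ c'.openCard i j := by
  induction h with
  | refl => exact le_rfl
  | tail _ h ih => exact ih.trans (h.openCard_le hij)

theorem card_filter_val_lt {n i : ℕ} (hi : i ≤ n) :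
    (Finset.univ.filter fun k : Fin n => (k : ℕ) < i).card = i := by
  have : (Finset.univ.filter fun k : Fin n => (k : ℕ) < i) =
      (Finset.univ : Finset (Fin i)).map (Fin.castLEEmb hi) := by
    ext k
    simp only [Finset.mem_filter, Finset.mem_univ, true_and, Finset.mem_map]
    exact ⟨fun h => ⟨⟨k, h⟩, Fin.ext rfl⟩, by rintro ⟨a, rfl⟩; exact a.2⟩
  rw [this, Finset.card_map, Finset.card_univ, Fintype.card_fin]

theorem card_closedSet_add_openCard (c : Clan p q) {i : ℕ} (hi : i ≤ p + q) (j : ℕ) :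
    (c.closedSet i j).card + c.openCard i j = i := by
  conv_rhs => rw [← card_filter_val_lt hi]
  rw [closedSet, openCard, ← Finset.card_union_of_disjoint]
  · congr 1
    ext k
    simp only [Finset.mem_union, Finset.mem_filter, Finset.mem_univ, true_and]
    omega
  · rw [Finset.disjoint_filter]
    intro k _ h
    omega

/-- The length of a clan is the number of pairs `i < x ≤ mate i` with `i ≤ mate x`. -/
theorem len_eq (c : Clan p q) : c.len = ((∑ i, ∑ x,
    if i < x ∧ x ≤ c.mate i ∧ i ≤ c.mate x then 1 else 0 : ℕ) : ℤ) := by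
  have term : ∀ i : Fin (p + q), i < c.mate i →
      (((c.mate i : ℕ) : ℤ) - ((i : ℕ) : ℤ) -
      ((Finset.univ.filter (fun st : Fin (p + q) × Fin (p + q) =>
          c.IsMatch st.1 st.2 ∧ st.1 < i ∧ i < st.2 ∧ st.2 < c.mate i)).card : ℤ)) =
      ((∑ x, if i < x ∧ x ≤ c.mate i ∧ i ≤ c.mate x then 1 else 0 : ℕ) : ℤ) := by
    intro i hi
    have h1 : (Finset.univ.filter (fun st : Fin (p + q) × Fin (p + q) =>
          c.IsMatch st.1 st.2 ∧ st.1 < i ∧ i < st.2 ∧ st.2 < c.mate i)).card =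
        ((Finset.Ioc i (c.mate i)).filter fun x => ¬ i ≤ c.mate x).card := by
      refine Finset.card_nbij' (fun st => st.2) (fun x => (c.mate x, x)) ?_ ?_ ?_ ?_
      · rintro ⟨s, t⟩ h
        simp only [Finset.coe_filter, Finset.mem_univ, true_and, Set.mem_ofPred_eq, Finset.mem_Ioc] at h ⊢
        simp only [IsMatch] at h ⊢
        obtain ⟨⟨h1, rfl⟩, h2, h3, h4⟩ := h
        exact ⟨⟨h3, h4.le⟩, by rw [c.mate_invol]; exact not_le.2 h2⟩
      · intro x h
        simp only [Finset.coe_filter, Finset.mem_univ, true_and, Set.mem_ofPred_eq, Finset.mem_Ioc] at h ⊢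
        simp only [IsMatch, not_le, c.mate_invol, and_true] at h ⊢
        obtain ⟨⟨h1, h2⟩, h3⟩ := h
        refine ⟨h3.trans h1, h3, h1, lt_of_le_of_ne h2 ?_⟩
        rintro rfl
        rw [c.mate_invol] at h3
        exact lt_irrefl _ h3
      · rintro ⟨s, t⟩ h
        simp only [Finset.coe_filter, Finset.mem_univ, true_and, Set.mem_ofPred_eq] at h
        simp only [IsMatch] at h
        obtain ⟨⟨h1, rfl⟩, h2, h3, h4⟩ := h
        simp [c.mate_invol]
      · intro x h
        rfl
    have h2 : (∑ x, if i < x ∧ x ≤ c.mate i ∧ i ≤ c.mate x then 1 else 0 : ℕ) =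
        ((Finset.Ioc i (c.mate i)).filter fun x => i ≤ c.mate x).card := by
      rw [← Finset.card_filter]
      congr 1
      ext x
      simp [and_assoc]
    have h3 := Finset.card_filter_add_card_filter_not (s := Finset.Ioc i (c.mate i))
      (fun x => i ≤ c.mate x)
    rw [Fin.card_Ioc] at h3
    rw [h1, h2]
    have : (i : ℕ) < c.mate i := hi
    omega
  have hl : ∀ i : Fin (p + q), ¬ i < c.mate i →
      (∑ x, if i < x ∧ x ≤ c.mate i ∧ i ≤ c.mate x then 1 else 0 : ℕ) = 0 := by
    intro i hi
    refine Finset.sum_eq_zero fun x _ => if_neg ?_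
    rintro ⟨h1, h2, -⟩
    exact hi (h1.trans_le h2)
  rw [len, Nat.cast_sum, ← Finset.sum_filter_add_sum_filter_not Finset.univ
    (fun i => i < c.mate i), Finset.sum_eq_zero (s := Finset.univ.filter fun i => ¬ i < c.mate i),
    add_zero]
  · refine Finset.sum_nbij' (fun ij => ij.1) (fun i => (i, c.mate i)) ?_ ?_ ?_ ?_ ?_
    · rintro ⟨i, j⟩ h
      simp only [Finset.mem_filter, Finset.mem_univ, true_and] at h ⊢
      obtain ⟨h1, rfl⟩ := h
      exact h1
    · intro i h
      simp only [Finset.mem_filter, Finset.mem_univ, true_and] at h ⊢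
      exact ⟨h, rfl⟩
    · rintro ⟨i, j⟩ h
      simp only [Finset.mem_filter, Finset.mem_univ, true_and] at h ⊢
      rw [h.2]
    · intro i h
      rfl
    · rintro ⟨i, j⟩ h
      simp only [Finset.mem_filter, Finset.mem_univ, true_and] at h
      obtain ⟨h1, rfl⟩ := h
      exact term i h1
  · intro i hi
    rw [hl i (by simpa using hi), Nat.cast_zero]

namespace Pattern

variable {θ : Clan r s} {γ : Clan p q} {ι : Fin (p + q) → Fin (r + s)}

theorem mate_apply (h : Pattern θ γ ι) (k : Fin (p + q)) : θ.mate (ι k) = ι (γ.mate k) := by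
  rcases lt_trichotomy k (γ.mate k) with hk | hk | hk
  · exact (h.2.2 k _ ⟨hk, rfl⟩).2
  · rw [(h.2.1 k hk.symm).1, ← hk]
  · rw [← (h.2.2 _ k ⟨hk, γ.mate_invol k⟩).2, θ.mate_invol]

theorem isPlus_iff (h : Pattern θ γ ι) (k : Fin (p + q)) : θ.IsPlus (ι k) ↔ γ.IsPlus k := by
  by_cases hk : γ.mate k = k
  · simp [IsPlus, h.2.1 k hk, hk]
  · simp [IsPlus, h.mate_apply, hk, h.1.injective.eq_iff]

theorem isMinus_iff (h : Pattern θ γ ι) (k : Fin (p + q)) : θ.IsMinus (ι k) ↔ γ.IsMinus k := by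
  by_cases hk : γ.mate k = k
  · simp [IsMinus, h.2.1 k hk, hk]
  · simp [IsMinus, h.mate_apply, hk, h.1.injective.eq_iff]

theorem isPos_iff (h : Pattern θ γ ι) (k : Fin (p + q)) : θ.IsPos (ι k) ↔ γ.IsPos k := by
  rw [IsPos, IsPos, h.isPlus_iff, IsLeft, IsLeft, h.mate_apply, h.1.lt_iff_lt]

theorem mate_outside (h : Pattern θ γ ι) {m : Fin (r + s)} (hm : ∀ k, ι k ≠ m) (k) :
    ι k ≠ θ.mate m := by
  intro hk
  apply hm (γ.mate k)
  rw [← h.mate_apply, hk, θ.mate_invol]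

end Pattern

/-- The indices outside the range of `ι`. -/
def outside (ι : Fin (p + q) → Fin (r + s)) : Finset (Fin (r + s)) :=
  Finset.univ.filter fun m => ∀ k, ι k ≠ m

theorem mem_outside {ι : Fin (p + q) → Fin (r + s)} {m : Fin (r + s)} :
    m ∈ outside ι ↔ ∀ k, ι k ≠ m := by
  simp [outside]

theorem sum_eq_sum_comp_add_sum_outside {A : Type*} [AddCommMonoid A]
    {ι : Fin (p + q) → Fin (r + s)} (hι : Function.Injective ι) (F : Fin (r + s) → A) :
    ∑ i, F i = ∑ a, F (ι a) + ∑ i ∈ outside ι, F i := by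
  rw [← Finset.sum_add_sum_compl (Finset.univ.map ⟨ι, hι⟩), Finset.sum_map]
  congr 2
  ext m
  simp [mem_outside]

theorem card_filter_eq_comp_add_outside {ι : Fin (p + q) → Fin (r + s)}
    (hι : Function.Injective ι) (f : Fin (r + s) → Prop) [DecidablePred f] :
    (Finset.univ.filter f).card =
      (Finset.univ.filter fun a => f (ι a)).card + ((outside ι).filter f).card := by
  rw [Finset.card_filter, sum_eq_sum_comp_add_sum_outside hι, ← Finset.card_filter,
    ← Finset.card_filter]

/-- The number of positions `a` of `γ` such that `ι a` lies before, and the image of the mate of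
`a` lies after, both `x` and `y`. -/
def nestCard (γ : Clan p q) (ι : Fin (p + q) → Fin (r + s)) (x y : Fin (r + s)) : ℕ :=
  ∑ a, if ι a < x ∧ ι a < y ∧ x < ι (γ.mate a) ∧ y < ι (γ.mate a) then 1 else 0

theorem nestCard_comm (γ : Clan p q) (ι : Fin (p + q) → Fin (r + s)) (x y : Fin (r + s)) :
    nestCard γ ι x y = nestCard γ ι y x :=
  Finset.sum_congr rfl fun _ _ => if_congr (by tauto) rfl rfl

theorem Pattern.sum_add_sum_eq_nestCard_add {θ : Clan r s} {γ : Clan p q}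
    {ι : Fin (p + q) → Fin (r + s)} (h : Pattern θ γ ι) {x : Fin (r + s)} (hx : ∀ k, ι k ≠ x) :
    (∑ a, if ι a < x ∧ x ≤ θ.mate (ι a) ∧ ι a ≤ θ.mate x then 1 else 0) +
      (∑ b, if x < ι b ∧ ι b ≤ θ.mate x ∧ x ≤ θ.mate (ι b) then 1 else 0) =
    nestCard γ ι x (θ.mate x) + ∑ b, if x < ι b ∧ ι b < θ.mate x then 1 else 0 := by
  have hy := h.mate_outside hx
  generalize θ.mate x = y at hy ⊢
  have e1 : (∑ a, if ι a < x ∧ x ≤ θ.mate (ι a) ∧ ι a ≤ y then 1 else 0) =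
      nestCard γ ι x y +
        ∑ a, if ι a < x ∧ x < ι (γ.mate a) ∧ ι (γ.mate a) < y then 1 else 0 := by
    rw [nestCard, ← Finset.sum_add_distrib]
    refine Finset.sum_congr rfl fun a _ => ?_
    rw [h.mate_apply]
    have := hx a
    have := hx (γ.mate a)
    have := hy a
    have := hy (γ.mate a)
    split_ifs <;> omega
  have e2 : (∑ b, if x < ι b ∧ ι b < y then 1 else 0) =
      (∑ b, if x < ι b ∧ ι b ≤ y ∧ x ≤ θ.mate (ι b) then 1 else 0) +
        ∑ b, if ι (γ.mate b) < x ∧ x < ι b ∧ ι b < y then 1 else 0 := by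
    rw [← Finset.sum_add_distrib]
    refine Finset.sum_congr rfl fun a _ => ?_
    rw [h.mate_apply]
    have := hy a
    split_ifs <;> omega
  have e3 : (∑ a, if ι a < x ∧ x < ι (γ.mate a) ∧ ι (γ.mate a) < y then 1 else 0) =
      ∑ b, if ι (γ.mate b) < x ∧ x < ι b ∧ ι b < y then 1 else 0 := by
    refine Finset.sum_nbij' γ.mate γ.mate (by simp) (by simp) (fun a _ => γ.mate_invol a)
      (fun a _ => γ.mate_invol a) fun a _ => ?_
    rw [γ.mate_invol]
  omega

theorem Pattern.len_eq {θ : Clan r s} {γ : Clan p q}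
    {ι : Fin (p + q) → Fin (r + s)} (h : Pattern θ γ ι) :
    θ.len = γ.len + ((∑ x ∈ outside ι, nestCard γ ι x (θ.mate x) : ℕ) : ℤ) +
      ((∑ x ∈ outside ι, ∑ b, if x < ι b ∧ ι b < θ.mate x then 1 else 0 : ℕ) : ℤ) +
      ((∑ i ∈ outside ι, ∑ x ∈ outside ι,
        if i < x ∧ x ≤ θ.mate i ∧ i ≤ θ.mate x then 1 else 0 : ℕ) : ℤ) := by
  have e1 : ∀ i : Fin (r + s), (∑ x, if i < x ∧ x ≤ θ.mate i ∧ i ≤ θ.mate x then 1 else 0 : ℕ) =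
      (∑ b, if i < ι b ∧ ι b ≤ θ.mate i ∧ i ≤ θ.mate (ι b) then 1 else 0) +
        ∑ x ∈ outside ι, if i < x ∧ x ≤ θ.mate i ∧ i ≤ θ.mate x then 1 else 0 := fun i =>
    sum_eq_sum_comp_add_sum_outside h.1.injective _
  have e2 : ∀ a : Fin (p + q),
      (∑ b, if ι a < ι b ∧ ι b ≤ θ.mate (ι a) ∧ ι a ≤ θ.mate (ι b) then 1 else 0 : ℕ) =
      ∑ b, if a < b ∧ b ≤ γ.mate a ∧ a ≤ γ.mate b then 1 else 0 := fun a =>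
    Finset.sum_congr rfl fun b _ => by
      simp only [h.mate_apply, h.1.lt_iff_lt, h.1.le_iff_le]
  rw [Clan.len_eq θ, Clan.len_eq γ, sum_eq_sum_comp_add_sum_outside h.1.injective]
  simp only [e1, e2, Finset.sum_add_distrib]
  rw [Finset.sum_comm (s := Finset.univ) (t := outside ι)]
  have e3 := Finset.sum_congr rfl fun x (hx : x ∈ outside ι) =>
    h.sum_add_sum_eq_nestCard_add (mem_outside.1 hx)
  rw [Finset.sum_add_distrib, Finset.sum_add_distrib] at e3
  zify at e3 ⊢
  linarith

theorem Pattern.openCard_eq {θ : Clan r s} {γ : Clan p q}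
    {ι : Fin (p + q) → Fin (r + s)} (h : Pattern θ γ ι) {x y : Fin (r + s)} (hxy : x ≤ y) :
    θ.openCard x (y + 1) = nestCard γ ι x y +
      ((outside ι).filter fun k => k < x ∧ y < θ.mate k).card := by
  rw [openCard, card_filter_eq_comp_add_outside h.1.injective, nestCard, ← Finset.card_filter]
  congr 2
  ext a
  simp only [Finset.mem_filter, Finset.mem_univ, true_and, h.mate_apply]
  omega

namespace IntervalEmbed

variable {α γ : Clan p q} {β θ : Clan r s} {ι : Fin (p + q) → Fin (r + s)}

theorem nestCard_eq (h : IntervalEmbed α γ β θ ι) (hle : ble β θ) {x : Fin (r + s)}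
    (hx : ∀ k, ι k ≠ x) : nestCard α ι x (β.mate x) = nestCard γ ι x (β.mate x) := by
  obtain ⟨hθ, hβ, hag, hlen⟩ := h
  have key : ∀ x ∈ outside ι, nestCard α ι x (β.mate x) ≤ nestCard γ ι x (β.mate x) := by
    have : ∀ x y : Fin (r + s), x ≤ y → nestCard α ι x y ≤ nestCard γ ι x y := by
      intro x y hxy
      have h1 := hle.openCard_le (i := x) (j := y + 1) (by omega)
      rw [hβ.openCard_eq hxy, hθ.openCard_eq hxy] at h1
      have h2 : ((outside ι).filter fun k => k < x ∧ y < β.mate k) =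
          (outside ι).filter fun k => k < x ∧ y < θ.mate k :=
        Finset.filter_congr fun k hk => by rw [(hag k (mem_outside.1 hk)).1]
      rw [h2] at h1
      omega
    intro x _
    rcases le_total x (β.mate x) with hx | hx
    · exact this _ _ hx
    · rw [nestCard_comm, nestCard_comm γ]
      exact this _ _ hx
  refine (Finset.sum_eq_sum_iff_of_le key).1 ?_ x (mem_outside.2 hx)
  have hm : ∀ x ∈ outside ι, θ.mate x = β.mate x := fun x hx =>
    ((hag x (mem_outside.1 hx)).1).symm
  have e1 : ∑ x ∈ outside ι, nestCard γ ι x (θ.mate x) =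
      ∑ x ∈ outside ι, nestCard γ ι x (β.mate x) :=
    Finset.sum_congr rfl fun x hx => by rw [hm x hx]
  have e2 : (∑ x ∈ outside ι, ∑ b, if x < ι b ∧ ι b < θ.mate x then 1 else 0 : ℕ) =
      ∑ x ∈ outside ι, ∑ b, if x < ι b ∧ ι b < β.mate x then 1 else 0 :=
    Finset.sum_congr rfl fun x hx => by rw [hm x hx]
  have e3 : (∑ i ∈ outside ι, ∑ x ∈ outside ι,
        if i < x ∧ x ≤ θ.mate i ∧ i ≤ θ.mate x then 1 else 0 : ℕ) =
      ∑ i ∈ outside ι, ∑ x ∈ outside ι,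
        if i < x ∧ x ≤ β.mate i ∧ i ≤ β.mate x then 1 else 0 :=
    Finset.sum_congr rfl fun i hi => Finset.sum_congr rfl fun x hx => by rw [hm x hx, hm i hi]
  have h1 := hθ.len_eq
  have h2 := hβ.len_eq
  rw [e1, e2, e3] at h1
  zify
  push_cast at h1 h2
  linarith

theorem openCard_eq (h : IntervalEmbed α γ β θ ι) (hle : ble β θ) {x : Fin (r + s)}
    (hx : ∀ k, ι k ≠ x) (hx' : x ≤ β.mate x) :
    θ.openCard x (β.mate x + 1) = β.openCard x (β.mate x + 1) := by
  rw [h.1.openCard_eq hx', h.2.1.openCard_eq hx', h.nestCard_eq hle hx]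
  congr 2
  exact Finset.filter_congr fun k hk => by rw [(h.2.2.1 k (mem_outside.1 hk)).1]

theorem closedSet_card_eq (h : IntervalEmbed α γ β θ ι) (hle : ble β θ) {x : Fin (r + s)}
    (hx : ∀ k, ι k ≠ x) (hx' : x ≤ β.mate x) :
    (β.closedSet x (β.mate x)).card = (θ.closedSet x (β.mate x)).card ∧
    (β.closedSet (x + 1) (β.mate x + 1)).card = (θ.closedSet (x + 1) (β.mate x + 1)).card := by
  have hm := (h.2.2.1 x hx).1
  have e1 : ∀ c : Clan r s, c.mate x = β.mate x →
      c.openCard x (β.mate x) = c.openCard x (β.mate x + 1) := by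
    intro c hc
    refine congrArg Finset.card (Finset.filter_congr fun k _ => ?_)
    refine and_congr_right fun hk => ?_
    have : c.mate k ≠ β.mate x := fun e => by
      rw [← hc] at e
      have := congrArg c.mate e
      rw [c.mate_invol, c.mate_invol] at this
      omega
    omega
  have e2 : ∀ c : Clan r s, c.mate x = β.mate x →
      c.openCard (x + 1) (β.mate x + 1) = c.openCard x (β.mate x + 1) := by
    intro c hc
    refine congrArg Finset.card (Finset.filter_congr fun k _ => ?_)
    refine and_congr_left fun hk => ?_
    have : k ≠ x := by
      rintro rfl
      rw [hc] at hk
      omega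
    omega
  have hx1 := x.2
  have c1 := β.card_closedSet_add_openCard (i := x) (by omega) (β.mate x)
  have c2 := θ.card_closedSet_add_openCard (i := x) (by omega) (β.mate x)
  have c3 := β.card_closedSet_add_openCard (i := x + 1) (by omega) (β.mate x + 1)
  have c4 := θ.card_closedSet_add_openCard (i := x + 1) (by omega) (β.mate x + 1)
  rw [e1 _ rfl] at c1
  rw [e1 _ hm.symm] at c2
  rw [e2 _ rfl] at c3
  rw [e2 _ hm.symm] at c4
  have := h.openCard_eq hle hx hx'
  omega

end IntervalEmbed

theorem card_isLeft_eq_card_isRight (c : Clan p q) :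
    (Finset.univ.filter fun k => k < c.mate k).card =
      (Finset.univ.filter fun k => c.mate k < k).card :=
  Finset.card_nbij' c.mate c.mate (fun k hk => by simpa [c.mate_invol] using hk)
    (fun k hk => by simpa [c.mate_invol] using hk) (fun k _ => c.mate_invol k)
    fun k _ => c.mate_invol k

theorem card_isPos (c : Clan p q) :
    (Finset.univ.filter c.IsPos).card = p ∧
    (Finset.univ.filter fun k => ¬ c.IsPos k).card = q ∧
    (Finset.univ.filter fun k => c.IsMinus k ∨ c.IsLeft k).card = q := by
  have h1 := Finset.card_filter_add_card_filter_not (s := Finset.univ) c.IsPos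
  have h2 : (Finset.univ.filter c.IsPos).card = (Finset.univ.filter c.IsPlus).card +
      (Finset.univ.filter fun k => k < c.mate k).card := by
    rw [← Finset.card_union_of_disjoint, ← Finset.filter_or]
    · refine congrArg Finset.card ?_
      ext k
      simp [IsPos, IsLeft]
    · rw [Finset.disjoint_filter]
      exact fun k _ h h' => h'.ne h.1.symm
  have h3 : (Finset.univ.filter fun k => c.IsMinus k ∨ c.IsLeft k).card =
      (Finset.univ.filter c.IsMinus).card + (Finset.univ.filter fun k => k < c.mate k).card := by
    rw [Finset.filter_or, Finset.card_union_of_disjoint]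
    · refine congrArg _ (congrArg Finset.card ?_)
      ext k
      simp [IsLeft]
    · rw [Finset.disjoint_filter]
      exact fun k _ h h' => h'.ne h.1.symm
  have h4 : (Finset.univ.filter fun k => ¬ c.IsPos k).card =
      (Finset.univ.filter c.IsMinus).card + (Finset.univ.filter fun k => c.mate k < k).card := by
    rw [← Finset.card_union_of_disjoint, ← Finset.filter_or]
    · refine congrArg Finset.card (Finset.filter_congr fun k _ => ?_)
      rcases c.position_cases k with ⟨h, h', h''⟩ | ⟨h, h', h''⟩ | ⟨h, h'⟩ | ⟨h, h'⟩
      · simp [h, h'', IsMinus, h'.2]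
      · simp [h', h'']
      · simp [h', IsMinus, h.ne', h.le]
      · simp [h', h]
    · rw [Finset.disjoint_filter]
      exact fun k _ h h' => h'.ne h.1
  have h5 : (Finset.univ.filter c.IsPlus).card + q = (Finset.univ.filter c.IsMinus).card + p := by
    convert c.plus_minus <;> rfl
  have h6 := c.card_isLeft_eq_card_isRight
  rw [Finset.card_univ, Fintype.card_fin] at h1
  omega

theorem wNat_of_isPos {c : Clan p q} {k : Fin (p + q)} (h : c.IsPos k) :
    c.wNat k = (Finset.univ.filter fun j => c.IsPos j ∧ j < k).card := by
  rw [wNat, if_pos (show c.IsPlus k ∨ c.IsLeft k from h)]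
  congr!

theorem wNat_of_not_isPos {c : Clan p q} {k : Fin (p + q)} (h : ¬ c.IsPos k) :
    c.wNat k = p +
      (Finset.univ.filter fun j => (c.IsMinus j ∨ c.IsLeft j) ∧ j < c.mate k).card := by
  have : (if c.IsMinus k then k else c.mate k) = c.mate k := by
    split_ifs with h'
    · exact h'.1.symm
    · rfl
  rw [wNat, if_neg (show ¬ (c.IsPlus k ∨ c.IsLeft k) from h), this]

theorem wNat_lt_iff_of_isPos {c : Clan p q} {k : Fin (p + q)} : c.wNat k < p ↔ c.IsPos k := by
  constructor
  · intro h
    by_contra h'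
    rw [wNat_of_not_isPos h'] at h
    omega
  · intro h
    rw [wNat_of_isPos h]
    conv_rhs => rw [← c.card_isPos.1]
    refine Finset.card_lt_card (Finset.ssubset_iff_of_subset ?_ |>.2 ⟨k, by simpa using h, by simp⟩)
    exact fun j hj => by simpa using (Finset.mem_filter.1 hj).2.1

theorem isMinus_or_isLeft_mate {c : Clan p q} {k : Fin (p + q)} (h : ¬ c.IsPos k) :
    c.IsMinus (c.mate k) ∨ c.IsLeft (c.mate k) := by
  rcases c.position_cases k with ⟨-, -, h'⟩ | ⟨h1, h2, -⟩ | ⟨-, h'⟩ | ⟨h1, -⟩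
  · exact absurd h' h
  · rw [h1]; exact Or.inl h2
  · exact absurd h' h
  · right; rwa [IsLeft, c.mate_invol]

theorem wNat_lt (c : Clan p q) (k : Fin (p + q)) : c.wNat k < p + q := by
  by_cases h : c.IsPos k
  · have := wNat_lt_iff_of_isPos.2 h
    omega
  · rw [wNat_of_not_isPos h]
    conv_rhs => rw [← c.card_isPos.2.2]
    refine Nat.add_lt_add_left (Finset.card_lt_card
      (Finset.ssubset_iff_of_subset ?_ |>.2
        ⟨c.mate k, by simpa using isMinus_or_isLeft_mate h, by simp⟩)) _
    exact fun j hj => by simpa using (Finset.mem_filter.1 hj).2.1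

theorem card_filter_and_lt_lt {n : ℕ} (f : Fin n → Prop) [DecidablePred f] {a b : Fin n} (ha : f a) (hab : a < b) :
    (Finset.univ.filter fun j => f j ∧ j < a).card <
      (Finset.univ.filter fun j => f j ∧ j < b).card := by
  refine Finset.card_lt_card (Finset.ssubset_iff_of_subset ?_ |>.2 ⟨a, by simp [ha, hab], by simp⟩)
  exact Finset.monotone_filter_right _ fun j _ h => ⟨h.1, h.2.trans hab⟩

theorem wNat_lt_wNat_of_isPos {c : Clan p q} {k l : Fin (p + q)} (hk : c.IsPos k)
    (hl : c.IsPos l) : c.wNat k < c.wNat l ↔ k < l := by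
  rw [wNat_of_isPos hk, wNat_of_isPos hl]
  refine ⟨fun h => ?_, card_filter_and_lt_lt _ hk⟩
  by_contra h'
  rcases (not_lt.1 h').eq_or_lt with h' | h'
  · rw [h'] at h; exact lt_irrefl _ h
  · exact lt_asymm h (card_filter_and_lt_lt _ hl h')

theorem wNat_lt_wNat_of_not_isPos {c : Clan p q} {k l : Fin (p + q)} (hk : ¬ c.IsPos k)
    (hl : ¬ c.IsPos l) : c.wNat k < c.wNat l ↔ c.mate k < c.mate l := by
  rw [wNat_of_not_isPos hk, wNat_of_not_isPos hl, add_lt_add_iff_left]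
  refine ⟨fun h => ?_, card_filter_and_lt_lt _ (isMinus_or_isLeft_mate hk)⟩
  by_contra h'
  rcases (not_lt.1 h').eq_or_lt with h' | h'
  · rw [h'] at h; exact lt_irrefl _ h
  · exact lt_asymm h (card_filter_and_lt_lt _ (isMinus_or_isLeft_mate hl) h')

theorem mate_injective (c : Clan p q) : Function.Injective c.mate :=
  Function.LeftInverse.injective c.mate_invol

theorem wNat_injective (c : Clan p q) : Function.Injective c.wNat := by
  intro k l h
  have hp : c.IsPos k ↔ c.IsPos l := by
    rw [← wNat_lt_iff_of_isPos, ← wNat_lt_iff_of_isPos, h]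
  by_cases hk : c.IsPos k
  · have h1 := wNat_lt_wNat_of_isPos hk (hp.1 hk)
    have h2 := wNat_lt_wNat_of_isPos (hp.1 hk) hk
    rw [h] at h1 h2
    omega
  · have h1 := wNat_lt_wNat_of_not_isPos hk (mt hp.2 hk)
    have h2 := wNat_lt_wNat_of_not_isPos (mt hp.2 hk) hk
    rw [h] at h1 h2
    exact c.mate_injective (by omega)

/-- The permutation `w_c`. -/
def wPerm (c : Clan p q) : Equiv.Perm (Fin (p + q)) :=
  Equiv.ofBijective (fun k => ⟨c.wNat k, c.wNat_lt k⟩)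
    (Finite.injective_iff_bijective.1 fun _ _ h => c.wNat_injective (congrArg Fin.val h))

theorem wPerm_val (c : Clan p q) (k : Fin (p + q)) : (c.wPerm k : ℕ) = c.wNat k := rfl

theorem eq_wPerm {c : Clan p q} {j k : Fin (p + q)} (h : (j : ℕ) = c.wNat k) : j = c.wPerm k :=
  Fin.ext h

/-- Relabelling the columns by positions turns membership in `S_c` into `Slice`. -/
theorem memS_iff_slice {c : Clan p q} {M : Matrix (Fin (p + q)) (Fin (p + q)) ℂ} :
    MemS c M ↔ Slice c (M.submatrix id c.wPerm) := by
  constructor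
  · rintro ⟨o1, o2, o3, o3', z1, z2, z3, z4, z5, z5', z6, z6', z7, z8, z9⟩
    have back : ∀ k, c.mate k < k → c.IsMatch (c.mate k) k := fun k hk => ⟨hk, c.mate_invol k⟩
    refine ⟨fun i => ?_, fun i hi => o2 i _ _ ⟨hi, rfl⟩ (Or.inr rfl),
      fun i hi => o3 i _ _ ⟨hi, rfl⟩ rfl, fun i k hi hk hki => ?_, fun i k hi hk hki => ?_,
      fun i k hi hk hk' => ?_, fun x k h h' => ?_, fun x k h h' => ?_, fun x k h h' => ?_,
      fun i k hi h h' => ?_, fun i j h h' h'' => ?_⟩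
    · rcases c.position_cases i with ⟨h, -⟩ | ⟨h, -⟩ | ⟨h, -⟩ | ⟨h, -⟩
      · exact o1 i _ h rfl
      · exact o1 i _ h rfl
      · exact o2 i _ _ ⟨h, rfl⟩ (Or.inl rfl)
      · exact o3' _ i _ (back i h) rfl
    · exact z1 i _ (Or.inl hi) (wNat_lt_iff_of_isPos.2 hk) fun h => hki (c.wNat_injective h)
    · exact z5 i _ hi (not_lt.1 (mt wNat_lt_iff_of_isPos.1 hk)) fun h => hki (c.wNat_injective h)
    · by_cases hp : c.IsPos k
      · exact z1 i _ (Or.inr hi) (wNat_lt_iff_of_isPos.2 hp) fun h => hk (c.wNat_injective h)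
      · exact z5' i _ _ ⟨hi, rfl⟩ (not_lt.1 (mt wNat_lt_iff_of_isPos.1 hp))
          fun h => hk' (c.wNat_injective h)
    · rcases c.position_cases k with ⟨-, -, hk⟩ | ⟨-, hk, -⟩ | ⟨-, hk⟩ | ⟨hk, -⟩
      · exact z2 k x _ hk rfl h
      · exact z6 k x _ hk rfl h
      · exact z2 k x _ hk rfl h
      · exact z6' _ k x _ (back k hk) rfl h'
    · exact z3 k _ x _ ⟨h.trans h', rfl⟩ rfl h h'
    · exact z7 _ k x _ (back k (h.trans h')) rfl h h'
    · by_cases hp : c.IsPos k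
      · exact z4 i _ _ ⟨hi, rfl⟩ ((wNat_lt_wNat_of_isPos (isPos_of_lt hi) hp).2 h)
          (wNat_lt_iff_of_isPos.2 hp)
      · refine z8 i _ _ ⟨hi, rfl⟩ ((wNat_lt_wNat_of_not_isPos (not_isPos_mate hi) hp).2 ?_)
        rwa [c.mate_invol]
    · exact z9 i j _ _ _ _ ⟨h.trans h', rfl⟩ ⟨(h'.trans h''), rfl⟩ h h' h'' rfl rfl
  · intro h
    have entry : ∀ i k, M i (c.wPerm k) = M.submatrix id c.wPerm i k := fun _ _ => rfl
    have pos : ∀ {i}, c.IsPos i → i ≤ c.mate i := fun {i} hi => by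
      by_contra h'
      exact not_isPos_of_lt (not_le.1 h') hi
    have neg : ∀ {i}, ¬ c.IsPos i → c.mate i ≤ i := fun {i} hi => by
      by_contra h'
      exact hi (isPos_of_lt (not_le.1 h'))
    refine ⟨?_, ?_, ?_, ?_, ?_, ?_, ?_, ?_, ?_, ?_, ?_, ?_, ?_, ?_, ?_⟩
    · intro i j _ hj
      rw [eq_wPerm hj]
      exact h.diag i
    · rintro i i' j ⟨hi, rfl⟩ (hj | hj)
      · rw [eq_wPerm hj]
        exact h.diag i
      · rw [eq_wPerm hj]
        exact h.left i hi
    · rintro i i' j ⟨hi, rfl⟩ hj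
      rw [eq_wPerm hj]
      exact h.right i hi
    · rintro i i' j - hj
      rw [eq_wPerm hj]
      exact h.diag i'
    · intro i j hi hj hji
      obtain ⟨k, rfl⟩ := c.wPerm.surjective j
      have hk := wNat_lt_iff_of_isPos.1 hj
      have hki : k ≠ i := fun h => hji (by rw [h, wPerm_val])
      rcases hi with hi | hi
      · exact h.plus_row i k hi hk hki
      · exact h.left_row i k hi hki fun h => not_isPos_mate hi (h ▸ hk)
    · intro i x j hi hj hx
      rw [eq_wPerm hj]
      exact h.above x i hx (hx.trans_le (pos hi))
    · rintro i i' x j ⟨-, rfl⟩ hj h1 h2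
      rw [eq_wPerm hj]
      exact h.between x i h1 h2
    · rintro i i' j ⟨hi, rfl⟩ h1 hj
      obtain ⟨k, rfl⟩ := c.wPerm.surjective j
      have hk := wNat_lt_iff_of_isPos.1 hj
      have hik := (wNat_lt_wNat_of_isPos (isPos_of_lt hi) hk).1 h1
      exact h.right_row i k hi hik (hik.trans_le (pos hk))
    · intro i j hi hj hji
      obtain ⟨k, rfl⟩ := c.wPerm.surjective j
      exact h.minus_row i k hi (mt wNat_lt_iff_of_isPos.2 (not_lt.2 hj))
        fun h => hji (by rw [h, wPerm_val])
    · rintro i i' j ⟨hi, rfl⟩ hj hji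
      obtain ⟨k, rfl⟩ := c.wPerm.surjective j
      have hk := mt wNat_lt_iff_of_isPos.2 (not_lt.2 hj)
      exact h.left_row i k hi (fun h => hk (h ▸ isPos_of_lt hi))
        fun h => hji (by rw [h, wPerm_val])
    · intro i x j hi hj hx
      rw [eq_wPerm hj]
      exact h.above x i hx (hi.1.symm ▸ hx)
    · rintro i i' x j ⟨hi, rfl⟩ hj hx
      rw [eq_wPerm hj]
      exact h.above x _ (hx.trans hi) (by rwa [c.mate_invol])
    · rintro i i' x j ⟨-, rfl⟩ hj h1 h2
      rw [eq_wPerm hj]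
      exact h.between' x _ (by rwa [c.mate_invol]) h2
    · rintro i i' j ⟨hi, rfl⟩ h1
      obtain ⟨k, rfl⟩ := c.wPerm.surjective j
      have hi' := not_isPos_mate hi
      have hk : ¬ c.IsPos k := fun hk => by
        have h2 := wNat_lt_iff_of_isPos.2 hk
        have h3 := mt wNat_lt_iff_of_isPos.1 hi'
        rw [wPerm_val] at h1
        omega
      have hik := (wNat_lt_wNat_of_not_isPos hi' hk).1 h1
      rw [c.mate_invol] at hik
      exact h.right_row i k hi (hik.trans_le (neg hk)) hik
    · rintro i j k l ci ck ⟨-, rfl⟩ ⟨-, rfl⟩ h1 h2 h3 hci hck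
      rw [eq_wPerm hci, eq_wPerm hck]
      exact h.cross i j h1 h2 h3

theorem sum_eq_sum_comp {n t : ℕ} {f : Fin t → Fin n} (hf : Function.Injective f)
    {F : Fin n → ℂ} (hF : ∀ k, (∀ y, f y ≠ k) → F k = 0) : ∑ k, F k = ∑ y, F (f y) :=
  (Fintype.sum_of_injective f hf _ _ (fun k hk => hF k fun y hy => hk ⟨y, hy⟩)
    fun _ => rfl).symm

theorem finrank_eq_of_bijOn {E E' : Type*} [AddCommGroup E] [Module ℂ E] [AddCommGroup E']
    [Module ℂ E'] {K : Submodule ℂ E} {K' : Submodule ℂ E'} (F : E →ₗ[ℂ] E')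
    (hF : Set.BijOn F K K') : Module.finrank ℂ K = Module.finrank ℂ K' := by
  exact (LinearEquiv.ofBijective (F.restrict hF.mapsTo) hF.bijective).finrank_eq

/-- Vectors supported on `T` whose image under `N` lies in the span of the first `i` standard basis
vectors. -/
def partKer (N : Matrix (Fin (p + q)) (Fin (p + q)) ℂ) (T : Fin (p + q) → Prop) (i : ℕ) :
    Submodule ℂ (Fin (p + q) → ℂ) where
  carrier := {x | (∀ k, ¬ T k → x k = 0) ∧ ∀ m : Fin (p + q), i ≤ m → (N.mulVec x) m = 0}
  add_mem' := by
    rintro x y ⟨hx, hx'⟩ ⟨hy, hy'⟩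
    exact ⟨fun k hk => by simp [hx k hk, hy k hk],
      fun m hm => by simp [Matrix.mulVec_add, hx' m hm, hy' m hm]⟩
  zero_mem' := by simp
  smul_mem' := by
    rintro a x ⟨hx, hx'⟩
    exact ⟨fun k hk => by simp [hx k hk], fun m hm => by simp [Matrix.mulVec_smul, hx' m hm]⟩

theorem rank_add_finrank_partKer {N : Matrix (Fin (p + q)) (Fin (p + q)) ℂ}
    {T : Fin (p + q) → Prop} {t i : ℕ} {f : Fin t → Fin (p + q)} (hf : Function.Injective f)
    (hT : ∀ k, T k ↔ ∃ y, f y = k) (A : Matrix (Fin (p + q - i)) (Fin t) ℂ)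
    (hA : ∀ x y, A x y = N ⟨i + (x : ℕ), by omega⟩ (f y)) :
    A.rank + Module.finrank ℂ (partKer N T i) = t := by
  have h1 := A.mulVecLin.finrank_range_add_finrank_ker
  rw [Module.finrank_fin_fun] at h1
  refine Eq.trans ?_ h1
  rw [Matrix.rank, add_right_inj]
  have key : ∀ x : Fin (p + q) → ℂ, (∀ k, ¬ T k → x k = 0) → ∀ m : Fin (p + q - i),
      A.mulVec (x ∘ f) m = N.mulVec x ⟨i + (m : ℕ), by omega⟩ := by
    intro x hx m
    have h2 : ∑ k, N ⟨i + (m : ℕ), by omega⟩ k * x k = _ := sum_eq_sum_comp hf ?_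
    · have h3 : A.mulVec (x ∘ f) m = ∑ y, A m y * x (f y) := rfl
      rw [h3]
      simp only [hA]
      exact h2.symm
    · intro k hk
      rw [hx k fun h => ?_, mul_zero]
      obtain ⟨y, hy⟩ := (hT k).1 h
      exact hk y hy
  refine finrank_eq_of_bijOn (LinearMap.funLeft ℂ ℂ f) ⟨?_, ?_, ?_⟩
  · rintro x ⟨hx, hx'⟩
    refine funext fun m => ?_
    exact (key x hx m).trans (hx' _ (Nat.le_add_right _ _))
  · rintro x ⟨hx, -⟩ y ⟨hy, -⟩ hxy
    funext k
    by_cases hk : T k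
    · obtain ⟨a, rfl⟩ := (hT k).1 hk
      exact congrFun hxy a
    · rw [hx k hk, hy k hk]
  · intro y hy
    have hcomp : Function.extend f y 0 ∘ f = y := funext fun a => hf.extend_apply _ _ a
    have hz : ∀ k, ¬ T k → Function.extend f y 0 k = 0 := fun k hk =>
      Function.extend_apply' _ _ _ (mt (hT k).2 hk)
    refine ⟨Function.extend f y 0, ⟨hz, fun m hm => ?_⟩, hcomp⟩
    have h2 := key _ hz ⟨m - i, by omega⟩
    rw [hcomp] at h2
    have h3 : (⟨i + ((⟨m - i, by omega⟩ : Fin (p + q - i)) : ℕ), by simp; omega⟩ : Fin (p + q)) = m :=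
      Fin.ext (by simp; omega)
    rw [h3] at h2
    rw [← h2]
    exact congrFun hy _

theorem swRank_add_finrank (c : Clan p q) (M : Matrix (Fin (p + q)) (Fin (p + q)) ℂ) (i : ℕ) :
    swRank p q M i + Module.finrank ℂ (partKer (M.submatrix id c.wPerm) c.IsPos i) = p := by
  refine rank_add_finrank_partKer (f := fun y => c.wPerm.symm (Fin.castAdd q y))
    (c.wPerm.symm.injective.comp (Fin.castAdd_injective p q)) (fun k => ?_) _ fun x y => ?_
  · rw [← wNat_lt_iff_of_isPos]
    constructor
    · intro h
      exact ⟨⟨c.wNat k, h⟩, c.wPerm.symm_apply_eq.2 (Fin.ext rfl)⟩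
    · rintro ⟨y, rfl⟩
      rw [← wPerm_val, Equiv.apply_symm_apply]
      exact y.2
  · simp only [Matrix.of_apply, Matrix.submatrix_apply, id, Equiv.apply_symm_apply]
    rfl

theorem seRank_add_finrank (c : Clan p q) (M : Matrix (Fin (p + q)) (Fin (p + q)) ℂ) (i : ℕ) :
    seRank p q M i +
      Module.finrank ℂ (partKer (M.submatrix id c.wPerm) (fun k => ¬ c.IsPos k) i) = q := by
  refine rank_add_finrank_partKer (f := fun y => c.wPerm.symm (Fin.natAdd p y))
    (c.wPerm.symm.injective.comp (Fin.natAdd_injective q p)) (fun k => ?_) _ fun x y => ?_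
  · rw [← wNat_lt_iff_of_isPos, not_lt]
    constructor
    · intro h
      have := c.wNat_lt k
      exact ⟨⟨c.wNat k - p, by omega⟩, c.wPerm.symm_apply_eq.2 (Fin.ext (by
        simp [wPerm_val]; omega))⟩
    · rintro ⟨y, rfl⟩
      rw [← wPerm_val, Equiv.apply_symm_apply]
      exact Nat.le_add_right _ _
  · simp only [Matrix.of_apply, Matrix.submatrix_apply, id, Equiv.apply_symm_apply]
    rfl

theorem Slice.isUnit {c : Clan p q} {N : Matrix (Fin (p + q)) (Fin (p + q)) ℂ}
    (h : Slice c N) : IsUnit N := by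
  rw [← Matrix.mulVec_injective_iff_isUnit]
  intro x y hxy
  have h1 : N.mulVec (x - y) = 0 := by rw [Matrix.mulVec_sub, sub_eq_zero.2 hxy]
  refine sub_eq_zero.1 (h.eq_zero_of_mem_flagKer (Nat.zero_le (p + q)) ⟨fun m _ => ?_, fun m hm => ?_⟩
    fun k hk => absurd hk (Nat.not_lt_zero _))
  · rw [h1]; rfl
  · have := m.2
    omega

/-- The matrix `M^{[i;j]}`. -/
def auxMatrix (M : Matrix (Fin (p + q)) (Fin (p + q)) ℂ) (i j : ℕ) :
    Matrix (Fin (p + q)) (Fin i ⊕ Fin j) ℂ :=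
  Matrix.of fun (x : Fin (p + q)) (y : Fin i ⊕ Fin j) =>
    Sum.elim
      (fun a : Fin i =>
        if p ≤ (x : ℕ) then (0 : ℂ)
        else if h : (a : ℕ) < p + q then M⁻¹ x ⟨(a : ℕ), h⟩ else 0)
      (fun b : Fin j =>
        if h : (b : ℕ) < p + q then M⁻¹ x ⟨(b : ℕ), h⟩ else 0) y

/-- Extension of a vector by zero. -/
def extendZero {i : ℕ} (n : ℕ) (u : Fin i → ℂ) : Fin n → ℂ :=
  fun m => if h : (m : ℕ) < i then u ⟨m, h⟩ else 0

theorem sum_mul_extendZero {n i : ℕ} (hi : i ≤ n) (u : Fin i → ℂ) (F : Fin n → ℂ) :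
    ∑ m, F m * extendZero n u m = ∑ a : Fin i, F (Fin.castLE hi a) * u a := by
  rw [sum_eq_sum_comp (Fin.castLE_injective hi)]
  · exact Finset.sum_congr rfl fun a _ => by simp [extendZero]
  · intro k hk
    rw [extendZero, dif_neg, mul_zero]
    exact fun h => hk ⟨k, h⟩ rfl

theorem auxMatrix_mulVec (M : Matrix (Fin (p + q)) (Fin (p + q)) ℂ) {i j : ℕ}
    (hi : i ≤ p + q) (hj : j ≤ p + q) (u : Fin i → ℂ) (v : Fin j → ℂ) (x : Fin (p + q)) :
    (auxMatrix M i j).mulVec (Sum.elim u v) x =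
      (if p ≤ (x : ℕ) then 0 else M⁻¹.mulVec (extendZero (p + q) u) x) +
        M⁻¹.mulVec (extendZero (p + q) v) x := by
  have e1 : M⁻¹.mulVec (extendZero (p + q) u) x = _ := sum_mul_extendZero hi u (M⁻¹ x)
  have e2 : M⁻¹.mulVec (extendZero (p + q) v) x = _ := sum_mul_extendZero hj v (M⁻¹ x)
  rw [e1, e2]
  have e3 : (auxMatrix M i j).mulVec (Sum.elim u v) x =
      ∑ k, auxMatrix M i j x k * Sum.elim u v k := rfl
  rw [e3, Fintype.sum_sum_type]
  congr 1
  · split_ifs with hx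
    · exact Finset.sum_eq_zero fun a _ => by simp [auxMatrix, hx]
    · refine Finset.sum_congr rfl fun a _ => ?_
      have := a.2
      simp [auxMatrix, hx, show (a : ℕ) < p + q by omega]
      exact Or.inl rfl
  · refine Finset.sum_congr rfl fun a _ => ?_
    have := a.2
    simp [auxMatrix, show (a : ℕ) < p + q by omega]
    exact Or.inl rfl

theorem extendZero_comp {n i : ℕ} (hi : i ≤ n) {y : Fin n → ℂ}
    (hy : ∀ m : Fin n, i ≤ m → y m = 0) :
    extendZero n (fun a : Fin i => y (Fin.castLE hi a)) = y := by
  funext m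
  by_cases h : (m : ℕ) < i
  · simp [extendZero, h]
  · simp [extendZero, h, hy m (not_lt.1 h)]

theorem auxRank_add_finrank {c : Clan p q} {M : Matrix (Fin (p + q)) (Fin (p + q)) ℂ}
    (h : Slice c (M.submatrix id c.wPerm)) {i j : ℕ} (hi : i ≤ p + q) (hj : j ≤ p + q) :
    auxRank p q M i j + Module.finrank ℂ (flagKer c (M.submatrix id c.wPerm) i j) = i + j := by
  have hM : IsUnit M.det := by
    rw [← Matrix.isUnit_iff_isUnit_det]
    exact (Matrix.isUnit_submatrix_equiv (Equiv.refl _) c.wPerm).1 h.isUnit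
  have hN : ∀ x, (M.submatrix id c.wPerm).mulVec x = M.mulVec (x ∘ c.wPerm.symm) := fun x =>
    Matrix.submatrix_mulVec_equiv M x id c.wPerm
  have hinv : ∀ x, M⁻¹.mulVec ((M.submatrix id c.wPerm).mulVec x) = x ∘ c.wPerm.symm := by
    intro x
    rw [hN, Matrix.mulVec_mulVec, Matrix.nonsing_inv_mul _ hM, Matrix.one_mulVec]
  have hpart : ∀ x k, part c.IsPos x (c.wPerm.symm k) =
      if p ≤ (k : ℕ) then 0 else x (c.wPerm.symm k) := by
    intro x k
    have : c.IsPos (c.wPerm.symm k) ↔ (k : ℕ) < p := by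
      rw [← wNat_lt_iff_of_isPos, ← wPerm_val, Equiv.apply_symm_apply]
    simp only [part, this, ← not_le, ite_not]
  change (auxMatrix M i j).rank + _ = _
  generalize M.submatrix id c.wPerm = N at h hN hinv ⊢
  have h1 := (auxMatrix M i j).mulVecLin.finrank_range_add_finrank_ker
  rw [Module.finrank_fintype_fun_eq_card, Fintype.card_sum, Fintype.card_fin,
    Fintype.card_fin] at h1
  refine Eq.trans ?_ h1
  rw [Matrix.rank, add_right_inj]
  have hadd : ∀ x y, part c.IsPos (x + y) = part c.IsPos x + part c.IsPos y := fun x y => by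
    funext k; simp only [part, Pi.add_apply]; split_ifs <;> simp
  have hsmul : ∀ (a : ℂ) x, part c.IsPos (a • x) = a • part c.IsPos x := fun a x => by
    funext k; simp [part]
  let F : (Fin (p + q) → ℂ) →ₗ[ℂ] (Fin i ⊕ Fin j → ℂ) :=
    { toFun := fun x => Sum.elim (fun a => N.mulVec x (Fin.castLE hi a))
        (fun b => -N.mulVec (part c.IsPos x) (Fin.castLE hj b))
      map_add' := fun x y => by
        rw [hadd, Matrix.mulVec_add, Matrix.mulVec_add]
        funext k
        rcases k with k | k <;> simp [add_comm]
      map_smul' := fun a x => by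
        rw [hsmul, Matrix.mulVec_smul, Matrix.mulVec_smul]
        funext k
        rcases k with k | k <;> simp }
  refine finrank_eq_of_bijOn F ⟨?_, ?_, ?_⟩
  · rintro x ⟨hx, hx'⟩
    refine funext fun r => ?_
    refine (auxMatrix_mulVec M hi hj _ _ r).trans ?_
    have e2 : extendZero (p + q) (fun b => -N.mulVec (part c.IsPos x) (Fin.castLE hj b)) =
        - N.mulVec (part c.IsPos x) :=
      extendZero_comp (y := - N.mulVec (part c.IsPos x)) hj fun m hm => by simp [hx' m hm]
    rw [extendZero_comp hi hx, e2, Matrix.mulVec_neg, hinv, hinv]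
    simp only [Function.comp_apply, Pi.neg_apply, hpart, add_neg_cancel, Pi.zero_apply]
  · rintro x ⟨hx, hx'⟩ y ⟨hy, hy'⟩ hxy
    have e1 : N.mulVec x = N.mulVec y := by
      funext m
      by_cases hm : (m : ℕ) < i
      · exact congrFun hxy (Sum.inl ⟨m, hm⟩)
      · rw [hx m (not_lt.1 hm), hy m (not_lt.1 hm)]
    exact Matrix.mulVec_injective_iff_isUnit.2 h.isUnit e1
  · intro z hz
    obtain ⟨u, v, rfl⟩ : ∃ u v, z = Sum.elim u v := ⟨_, _, (Sum.elim_comp_inl_inr z).symm⟩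
    have hz' : ∀ r : Fin (p + q), (if p ≤ (r : ℕ) then 0 else M⁻¹.mulVec (extendZero (p + q) u) r) =
        - M⁻¹.mulVec (extendZero (p + q) v) r := fun r =>
      eq_neg_of_add_eq_zero_left ((auxMatrix_mulVec M hi hj u v r).symm.trans (congrFun hz r))
    have e1 : N.mulVec ((M⁻¹.mulVec (extendZero (p + q) u)) ∘ c.wPerm) =
        extendZero (p + q) u := by
      rw [hN, Function.comp_assoc, Equiv.self_comp_symm, Function.comp_id, Matrix.mulVec_mulVec,
        Matrix.mul_nonsing_inv _ hM, Matrix.one_mulVec]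
    have e2 : N.mulVec (part c.IsPos ((M⁻¹.mulVec (extendZero (p + q) u)) ∘ c.wPerm)) =
        - extendZero (p + q) v := by
      have : part c.IsPos ((M⁻¹.mulVec (extendZero (p + q) u)) ∘ c.wPerm) ∘ c.wPerm.symm =
          - M⁻¹.mulVec (extendZero (p + q) v) := by
        funext r
        simp only [Function.comp_apply, hpart, Equiv.apply_symm_apply, hz', Pi.neg_apply]
      rw [hN, this, Matrix.mulVec_neg, Matrix.mulVec_mulVec,
        Matrix.mul_nonsing_inv _ hM, Matrix.one_mulVec]
    refine ⟨(M⁻¹.mulVec (extendZero (p + q) u)) ∘ c.wPerm, ⟨fun m hm => ?_, fun m hm => ?_⟩, ?_⟩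
    · rw [e1]; simp [extendZero, hm]
    · rw [e2]; simp [extendZero, hm]
    · change Sum.elim _ _ = Sum.elim u v
      rw [e1, e2]
      congr 1 <;> funext a <;> simp [extendZero]

theorem statPlus_eq (c : Clan p q) (i : ℕ) : c.statPlus i =
    (Finset.univ.filter fun k : Fin (p + q) =>
      c.IsPos k ∧ (k : ℕ) < i ∧ (c.mate k : ℕ) < i).card := by
  have h1 : (Finset.univ.filter fun ab : Fin (p + q) × Fin (p + q) =>
      c.IsMatch ab.1 ab.2 ∧ (ab.2 : ℕ) < i).card =
      (Finset.univ.filter fun k : Fin (p + q) => k < c.mate k ∧ (c.mate k : ℕ) < i).card := by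
    refine Finset.card_nbij' (fun ab => ab.1) (fun k => (k, c.mate k)) ?_ ?_ ?_ ?_
    · rintro ⟨a, b⟩ h
      simp only [Finset.coe_filter, Finset.mem_univ, true_and, Set.mem_ofPred_eq] at h ⊢
      obtain ⟨⟨h1, rfl⟩, h2⟩ := h
      exact ⟨h1, h2⟩
    · intro k h
      simp only [Finset.coe_filter, Finset.mem_univ, true_and, Set.mem_ofPred_eq] at h ⊢
      exact ⟨⟨h.1, rfl⟩, h.2⟩
    · rintro ⟨a, b⟩ h
      simp only [Finset.coe_filter, Finset.mem_univ, true_and, Set.mem_ofPred_eq] at h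
      obtain ⟨⟨h1, rfl⟩, h2⟩ := h
      rfl
    · exact fun k _ => rfl
  rw [statPlus, h1, ← Finset.card_union_of_disjoint, ← Finset.filter_or]
  · refine congrArg Finset.card ?_
    ext k
    simp only [Finset.mem_filter, Finset.mem_univ, true_and]
    rcases c.position_cases k with ⟨h, h', h''⟩ | ⟨h, h', h''⟩ | ⟨h, h'⟩ | ⟨h, h'⟩
    · simp [h, h', h'']
    · simp [h, h'', IsPlus, h'.2]
    · simp only [h, h', IsPlus, h.ne', false_and, and_false, false_or, true_and]
      omega
    · simp only [h', IsPlus, h.ne, false_and, and_false, false_or, iff_false]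
      omega
  · rw [Finset.disjoint_filter]
    exact fun k _ h h' => h'.1.ne h.2.1.symm

theorem statMinus_eq (c : Clan p q) (i : ℕ) : c.statMinus i =
    (Finset.univ.filter fun k : Fin (p + q) =>
      ¬ c.IsPos k ∧ (k : ℕ) < i ∧ (c.mate k : ℕ) < i).card := by
  have h1 : (Finset.univ.filter fun ab : Fin (p + q) × Fin (p + q) =>
      c.IsMatch ab.1 ab.2 ∧ (ab.2 : ℕ) < i).card =
      (Finset.univ.filter fun k : Fin (p + q) => c.mate k < k ∧ (k : ℕ) < i).card := by
    refine Finset.card_nbij' (fun ab => ab.2) (fun k => (c.mate k, k)) ?_ ?_ ?_ ?_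
    · rintro ⟨a, b⟩ h
      simp only [Finset.coe_filter, Finset.mem_univ, true_and, Set.mem_ofPred_eq] at h ⊢
      obtain ⟨⟨h1, rfl⟩, h2⟩ := h
      exact ⟨by rwa [c.mate_invol], h2⟩
    · intro k h
      simp only [Finset.coe_filter, Finset.mem_univ, true_and, Set.mem_ofPred_eq] at h ⊢
      exact ⟨⟨h.1, c.mate_invol k⟩, h.2⟩
    · rintro ⟨a, b⟩ h
      simp only [Finset.coe_filter, Finset.mem_univ, true_and, Set.mem_ofPred_eq] at h
      obtain ⟨⟨h1, rfl⟩, h2⟩ := h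
      simp [c.mate_invol]
    · exact fun k _ => rfl
  rw [statMinus, h1, ← Finset.card_union_of_disjoint, ← Finset.filter_or]
  · refine congrArg Finset.card ?_
    ext k
    simp only [Finset.mem_filter, Finset.mem_univ, true_and]
    rcases c.position_cases k with ⟨h, h', h''⟩ | ⟨h, h', h''⟩ | ⟨h, h'⟩ | ⟨h, h'⟩
    · simp [h, h'', IsMinus, h'.2]
    · simp [h, h', h'']
    · simp only [h', IsMinus, h.ne', false_and, and_false, false_or, not_true_eq_false, iff_false]
      omega
    · simp only [h, h', IsMinus, h.ne, false_and, and_false, false_or, not_false_eq_true, true_and]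
      omega
  · rw [Finset.disjoint_filter]
    exact fun k _ h h' => h'.1.ne h.2.1

theorem statMid_eq (c : Clan p q) {i j : ℕ} (hij : i ≤ j) : c.statMid i j = c.openCard i j := by
  refine Finset.card_nbij' (fun ab => ab.1) (fun k => (k, c.mate k)) ?_ ?_ ?_ ?_
  · rintro ⟨a, b⟩ h
    simp only [Finset.coe_filter, Finset.mem_univ, true_and, Set.mem_ofPred_eq] at h ⊢
    obtain ⟨⟨h1, rfl⟩, h2⟩ := h
    exact h2
  · intro k h
    simp only [Finset.coe_filter, Finset.mem_univ, true_and, Set.mem_ofPred_eq] at h ⊢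
    exact ⟨⟨by omega, rfl⟩, h⟩
  · rintro ⟨a, b⟩ h
    simp only [Finset.coe_filter, Finset.mem_univ, true_and, Set.mem_ofPred_eq] at h
    obtain ⟨⟨h1, rfl⟩, h2⟩ := h
    rfl
  · exact fun k _ => rfl

/-- The closed positions (those whose matching lies among the first `i` positions) of `θ` that lie
in `T`. -/
def closedCard (θ : Clan p q) (T : Fin (p + q) → Prop) (i : ℕ) : ℕ :=
  (Finset.univ.filter fun k : Fin (p + q) => T k ∧ (k : ℕ) < i ∧ (θ.mate k : ℕ) < i).card

/-- The conditions defining the Mars–Springer variety, for a matrix whose columns have been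
relabelled by positions. -/
structure RelabelledMarsSpringer (θ c : Clan p q) (N : Matrix (Fin (p + q)) (Fin (p + q)) ℂ) :
    Prop where
  slice : Slice c N
  pos : ∀ i, i ≤ p + q → closedCard θ θ.IsPos i ≤ Module.finrank ℂ (partKer N c.IsPos i)
  neg : ∀ i, i ≤ p + q → closedCard θ (fun k => ¬ θ.IsPos k) i ≤
    Module.finrank ℂ (partKer N (fun k => ¬ c.IsPos k) i)
  flag : ∀ i j, i ≤ j → j ≤ p + q →
    (θ.closedSet i j).card ≤ Module.finrank ℂ (flagKer c N i j)

theorem closedCard_zero (θ : Clan p q) (T : Fin (p + q) → Prop) : closedCard θ T 0 = 0 := by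
  simp [closedCard]

theorem finrank_partKer_add_le (c : Clan p q) (N : Matrix (Fin (p + q)) (Fin (p + q)) ℂ) (i : ℕ) :
    Module.finrank ℂ (partKer N c.IsPos i) +
      Module.finrank ℂ (partKer N (fun k => ¬ c.IsPos k) i) ≤
    Module.finrank ℂ (flagKer c N i i) := by
  have h1 := Submodule.finrank_sup_add_finrank_inf_eq (partKer N c.IsPos i)
    (partKer N (fun k => ¬ c.IsPos k) i)
  have h2 : partKer N c.IsPos i ⊓ partKer N (fun k => ¬ c.IsPos k) i = ⊥ := by
    rw [eq_bot_iff]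
    rintro x ⟨⟨hx, -⟩, hx', -⟩
    refine funext fun k => ?_
    by_cases hk : c.IsPos k
    · exact hx' k (not_not.2 hk)
    · exact hx k hk
  rw [h2, finrank_bot, add_zero] at h1
  rw [← h1]
  refine Submodule.finrank_mono (sup_le ?_ ?_)
  · rintro x ⟨hx, hx'⟩
    have : part c.IsPos x = x := by
      funext k
      by_cases hk : c.IsPos k
      · exact part_pos hk x
      · rw [part_neg hk, hx k hk]
    exact ⟨hx', by rwa [this]⟩
  · rintro x ⟨hx, hx'⟩
    have : part c.IsPos x = 0 := by
      funext k
      by_cases hk : c.IsPos k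
      · rw [part_pos hk, hx k (not_not.2 hk)]; rfl
      · exact part_neg hk x
    exact ⟨hx', by simp [this]⟩

theorem closedSet_card_eq_closedCard_add (θ : Clan p q) (i : ℕ) :
    (θ.closedSet i i).card = closedCard θ θ.IsPos i + closedCard θ (fun k => ¬ θ.IsPos k) i := by
  rw [← Finset.card_filter_add_card_filter_not θ.IsPos, closedCard, closedCard, closedSet,
    Finset.filter_filter, Finset.filter_filter]
  congr 2 <;> ext k <;> simp only [Finset.mem_filter, Finset.mem_univ, true_and] <;> tauto

theorem marsSpringer_iff {θ c : Clan p q} {M : Matrix (Fin (p + q)) (Fin (p + q)) ℂ} :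
    MarsSpringer θ c M ↔ RelabelledMarsSpringer θ c (M.submatrix id c.wPerm) := by
  have hp : ∀ i, θ.statPlus i = closedCard θ θ.IsPos i := θ.statPlus_eq
  have hm : ∀ i, θ.statMinus i = closedCard θ (fun k => ¬ θ.IsPos k) i := fun i => by
    rw [θ.statMinus_eq, closedCard]
    congr!
  have hp' : ∀ i, closedCard θ θ.IsPos i ≤ p := fun i => by
    conv_rhs => rw [← θ.card_isPos.1]
    exact Finset.card_le_card (Finset.monotone_filter_right _ fun k _ h => h.1)
  have hm' : ∀ i, closedCard θ (fun k => ¬ θ.IsPos k) i ≤ q := fun i => by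
    conv_rhs => rw [← θ.card_isPos.2.1]
    refine Finset.card_le_card fun k hk => ?_
    simp only [Finset.mem_filter, Finset.mem_univ, true_and] at hk ⊢
    exact hk.1
  constructor
  · rintro ⟨hS, h1, h2, h3⟩
    rw [memS_iff_slice] at hS
    have pos : ∀ i, i ≤ p + q → closedCard θ θ.IsPos i ≤
        Module.finrank ℂ (partKer (M.submatrix id c.wPerm) c.IsPos i) := by
      intro i hi
      rcases i.eq_zero_or_pos with rfl | hi'
      · simp [closedCard_zero]
      · have := h1 i hi' hi
        have := swRank_add_finrank c M i
        have := hp i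
        have := hp' i
        omega
    have neg : ∀ i, i ≤ p + q → closedCard θ (fun k => ¬ θ.IsPos k) i ≤
        Module.finrank ℂ (partKer (M.submatrix id c.wPerm) (fun k => ¬ c.IsPos k) i) := by
      intro i hi
      rcases i.eq_zero_or_pos with rfl | hi'
      · simp [closedCard_zero]
      · have := h2 i hi' hi
        have := seRank_add_finrank c M i
        have := hm i
        have := hm' i
        omega
    refine ⟨hS, pos, neg, fun i j hij hj => ?_⟩
    rcases hij.eq_or_lt with rfl | hij'
    · rw [closedSet_card_eq_closedCard_add]
      exact (add_le_add (pos i hj) (neg i hj)).trans (finrank_partKer_add_le c _ i)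
    · have h4 := θ.card_closedSet_add_openCard (hij.trans hj) j
      rcases i.eq_zero_or_pos with rfl | hi'
      · omega
      · have := h3 i j hi' hij' hj
        have := auxRank_add_finrank hS (hij.trans hj) hj
        have := θ.statMid_eq hij
        omega
  · rintro ⟨hS, h1, h2, h3⟩
    refine ⟨memS_iff_slice.2 hS, fun i _ hi => ?_, fun i _ hi => ?_, fun i j _ hij hj => ?_⟩
    · have := h1 i hi
      have := swRank_add_finrank c M i
      have := hp i
      omega
    · have := h2 i hi
      have := seRank_add_finrank c M i
      have := hm i
      omega
    · have := h3 i j hij.le hj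
      have := auxRank_add_finrank hS (hij.le.trans hj) hj
      have := θ.statMid_eq hij.le
      have := θ.card_closedSet_add_openCard (hij.le.trans hj) j
      omega

/-- The positions outside the range of `ι` only interact with their mates in the matrix `N`. -/
def Decoupled (c : Clan r s) (ι : Fin (p + q) → Fin (r + s))
    (N : Matrix (Fin (r + s)) (Fin (r + s)) ℂ) : Prop :=
  ∀ j, (∀ a, ι a ≠ j) → ∀ k, k ≠ j → k ≠ c.mate j → N j k = 0 ∧ N k j = 0

theorem IntervalEmbed.decoupled {α γ : Clan p q} {β θ : Clan r s}
    {ι : Fin (p + q) → Fin (r + s)} (h : IntervalEmbed α γ β θ ι) (hle : ble β θ)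
    {N : Matrix (Fin (r + s)) (Fin (r + s)) ℂ} (hN : RelabelledMarsSpringer θ β N) :
    Decoupled β ι N := by
  have hS := hN.slice
  have left : ∀ j, (∀ a, ι a ≠ j) → j < β.mate j → ∀ k, k ≠ j → k ≠ β.mate j →
      N j k = 0 ∧ N k j = 0 ∧ N (β.mate j) k = 0 ∧ N k (β.mate j) = 0 := by
    intro j hj hlt k hk hk'
    obtain ⟨h1, h2⟩ := h.closedSet_card_eq hle hj hlt.le
    have hlt' : (j : ℕ) < β.mate j := hlt
    have := (β.mate j).2
    have hc := hS.column_left_eq_zero hlt (h2.trans_le (hN.flag _ _ (by omega) (by omega))) k hk hk'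
    exact ⟨hS.left_row j k hlt hk hk', hc.1,
      hS.row_right_eq_zero hlt (h1.trans_le (hN.flag _ _ (by omega) (by omega))) k hk hk', hc.2⟩
  intro j hj k hk hk'
  rcases lt_trichotomy j (β.mate j) with hlt | he | hlt
  · have := left j hj hlt k hk hk'
    exact ⟨this.1, this.2.1⟩
  · obtain ⟨h1, h2⟩ := h.closedSet_card_eq hle hj he.le
    rw [← he] at h1 h2
    have := j.2
    exact ⟨hS.row_sign_eq_zero he.symm (h1.trans_le (hN.flag _ _ le_rfl (by omega))) k hk,
      hS.column_sign_eq_zero he.symm (h2.trans_le (hN.flag _ _ le_rfl (by omega))) k hk⟩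
  · have := left (β.mate j) (fun a => h.2.1.mate_outside hj a) (by rwa [β.mate_invol]) k hk'
      (by rwa [β.mate_invol])
    rw [β.mate_invol] at this
    exact this.2.2

theorem finrank_eq_finrank_add_card {ι : Fin (p + q) → Fin (r + s)} (hι : Function.Injective ι)
    {H : Finset (Fin (r + s))} (hH : H ⊆ outside ι) (σ : Fin (r + s) → Fin (r + s))
    {K : Submodule ℂ (Fin (r + s) → ℂ)} {K' : Submodule ℂ (Fin (p + q) → ℂ)}
    (hK : ∀ x, x ∈ K ↔ x ∘ ι ∈ K' ∧
      ∀ k, (∀ a, ι a ≠ k) → k ∉ H → x k = if σ k ∈ H then x (σ k) else 0) :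
    Module.finrank ℂ K = Module.finrank ℂ K' + H.card := by
  have h1 : Module.finrank ℂ (K'.prod (⊤ : Submodule ℂ (H → ℂ))) =
      Module.finrank ℂ K' + H.card := by
    have h2 := finrank_eq_of_bijOn (K := ⊤) (K' := K'.prod (⊤ : Submodule ℂ (H → ℂ)))
      (K'.subtype.prodMap LinearMap.id)
      ⟨fun x _ => ⟨x.1.2, trivial⟩, fun x _ y _ hxy => Prod.ext
        (Subtype.ext (congrArg (fun v => v.1) hxy)) (congrArg (fun v => v.2) hxy),
        fun x hx => ⟨(⟨x.1, hx.1⟩, x.2), trivial, rfl⟩⟩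
    rw [← h2, finrank_top, Module.finrank_prod]
    simp
  rw [← h1]
  refine finrank_eq_of_bijOn
    ((LinearMap.funLeft ℂ ℂ ι).prod (LinearMap.funLeft ℂ ℂ (Subtype.val : H → _))) ⟨?_, ?_, ?_⟩
  · exact fun x hx => ⟨((hK x).1 hx).1, trivial⟩
  · intro x hx y hy hxy
    obtain ⟨hx', hx⟩ := (hK x).1 hx
    obtain ⟨hy', hy⟩ := (hK y).1 hy
    have e1 : ∀ a, x (ι a) = y (ι a) := fun a => congrFun (congrArg Prod.fst hxy) a
    have e2 : ∀ k ∈ H, x k = y k := fun k hk => congrFun (congrArg Prod.snd hxy) ⟨k, hk⟩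
    funext k
    by_cases hk : ∃ a, ι a = k
    · obtain ⟨a, rfl⟩ := hk
      exact e1 a
    · push Not at hk
      by_cases hkH : k ∈ H
      · exact e2 k hkH
      · rw [hx k hk hkH, hy k hk hkH]
        split_ifs with h
        exacts [e2 _ h, rfl]
  · rintro ⟨y, z⟩ ⟨hy, -⟩
    set w : Fin (r + s) → ℂ := fun k => if h : k ∈ H then z ⟨k, h⟩ else 0 with hw
    set x : Fin (r + s) → ℂ := Function.extend ι y fun k => if k ∈ H then w k else w (σ k) with hx
    have e1 : x ∘ ι = y := Function.extend_comp hι _ _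
    have e2 : ∀ k, (∀ a, ι a ≠ k) → x k = if k ∈ H then w k else w (σ k) := fun k hk =>
      Function.extend_apply' _ _ _ fun ⟨a, ha⟩ => hk a ha
    have e3 : ∀ k ∈ H, x k = w k := fun k hk => by
      rw [e2 k (mem_outside.1 (hH hk)), if_pos hk]
    refine ⟨x, (hK x).2 ⟨by rwa [e1], fun k hk hkH => ?_⟩, Prod.ext e1 (funext fun k => ?_)⟩
    · rw [e2 k hk, if_neg hkH]
      split_ifs with h
      · exact (e3 _ h).symm
      · exact dif_neg h
    · exact (e3 k k.2).trans (dif_pos k.2)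

namespace Decoupled

variable {α : Clan p q} {β : Clan r s} {ι : Fin (p + q) → Fin (r + s)}
  {N : Matrix (Fin (r + s)) (Fin (r + s)) ℂ}

theorem mulVec_apply (hD : Decoupled β ι N) (hβ : Pattern β α ι) (x : Fin (r + s) → ℂ)
    (a : Fin (p + q)) : N.mulVec x (ι a) = (N.submatrix ι ι).mulVec (x ∘ ι) a := by
  refine (sum_eq_sum_comp hβ.1.injective (F := fun k => N (ι a) k * x k) fun k hk => ?_)
  rw [(hD k hk (ι a) (hk a) (hβ.mate_outside hk a)).2, zero_mul]

theorem mulVec_sign (hD : Decoupled β ι N) (hS : Slice β N) {j : Fin (r + s)}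
    (hj : ∀ a, ι a ≠ j) (hm : β.mate j = j) (x : Fin (r + s) → ℂ) : N.mulVec x j = x j := by
  rw [mulVec_eq_single j fun k hk => ?_, hS.diag, one_mul]
  rw [(hD j hj k hk (by rwa [hm])).1, zero_mul]

theorem mulVec_left (hS : Slice β N) {j : Fin (r + s)}
    (hm : j < β.mate j) (x : Fin (r + s) → ℂ) : N.mulVec x j = x j + x (β.mate j) := by
  rw [mulVec_eq_add j (β.mate j) hm.ne fun k hk hk' => ?_, hS.diag, one_mul, hS.left j hm, one_mul]
  rw [hS.left_row j k hm hk hk', zero_mul]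

theorem mulVec_right (hD : Decoupled β ι N) (hβ : Pattern β α ι) (hS : Slice β N) {j : Fin (r + s)}
    (hj : ∀ a, ι a ≠ j) (hm : j < β.mate j) (x : Fin (r + s) → ℂ) :
    N.mulVec x (β.mate j) = -x j + x (β.mate j) := by
  rw [mulVec_eq_add j (β.mate j) hm.ne fun k hk hk' => ?_, hS.diag, one_mul, hS.right j hm,
    neg_one_mul]
  rw [(hD (β.mate j) (hβ.mate_outside hj) k hk' (by rwa [β.mate_invol])).1, zero_mul]

theorem part_comp (hβ : Pattern β α ι) (x : Fin (r + s) → ℂ) :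
    part β.IsPos x ∘ ι = part α.IsPos (x ∘ ι) := by
  funext a
  simp [part, hβ.isPos_iff]

theorem finrank_flagKer (hD : Decoupled β ι N) (hβ : Pattern β α ι) (hS : Slice β N)
    {i j i' j' : ℕ} (hij : i ≤ j) (hi : ∀ a : Fin (p + q), (a : ℕ) < i' ↔ (ι a : ℕ) < i)
    (hj : ∀ a : Fin (p + q), (a : ℕ) < j' ↔ (ι a : ℕ) < j) :
    Module.finrank ℂ (flagKer β N i j) = Module.finrank ℂ (flagKer α (N.submatrix ι ι) i' j') +
      ((outside ι).filter fun k : Fin (r + s) => (k : ℕ) < i ∧ (β.mate k : ℕ) < j).card := by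
  refine finrank_eq_finrank_add_card hβ.1.injective (Finset.filter_subset _ _) β.mate fun x => ?_
  have hH : ∀ k : Fin (r + s), (∀ a, ι a ≠ k) →
      (k ∈ ((outside ι).filter fun k : Fin (r + s) => (k : ℕ) < i ∧ (β.mate k : ℕ) < j) ↔
      ((k : ℕ) < i ∧ (β.mate k : ℕ) < j)) := fun k hk => by
    rw [Finset.mem_filter, mem_outside, and_iff_right hk]
  have hpos : ∀ {k}, k < β.mate k → part β.IsPos x k = x k ∧ part β.IsPos x (β.mate k) = 0 :=
    fun {k} hk => ⟨part_pos (isPos_of_lt hk) x, part_neg (not_isPos_mate hk) x⟩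
  constructor
  · rintro ⟨h1, h2⟩
    refine ⟨⟨fun a ha => ?_, fun a ha => ?_⟩, fun k hk hkH => ?_⟩
    · rw [← hD.mulVec_apply hβ]
      exact h1 _ (by have := hi a; omega)
    · rw [← part_comp hβ, ← hD.mulVec_apply hβ]
      exact h2 _ (by have := hj a; omega)
    · rw [hH k hk] at hkH
      rw [if_congr (hH (β.mate k) (hβ.mate_outside hk)) rfl rfl, β.mate_invol]
      have key : ∀ l, (∀ a, ι a ≠ l) → l < β.mate l → (i ≤ l → x l + x (β.mate l) = 0) ∧
          (i ≤ β.mate l → x (β.mate l) = x l) ∧ (j ≤ β.mate l → x l = 0) := by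
        intro l hl hlt
        refine ⟨fun h => ?_, fun h => ?_, fun h => ?_⟩
        · rw [← mulVec_left hS hlt, h1 _ h]
        · have := h1 _ h
          rw [hD.mulVec_right hβ hS hl hlt] at this
          linear_combination this
        · have := h2 _ h
          rw [hD.mulVec_right hβ hS hl hlt, (hpos hlt).1, (hpos hlt).2] at this
          linear_combination -this
      have zero : ∀ l, (∀ a, ι a ≠ l) → l < β.mate l → i ≤ l → x l = 0 ∧ x (β.mate l) = 0 := by
        intro l hl hlt hil
        obtain ⟨e1, e2, -⟩ := key l hl hlt
        specialize e1 hil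
        specialize e2 (by omega)
        rw [e2] at e1 ⊢
        have : x l = 0 := by linear_combination e1 / 2
        exact ⟨this, this⟩
      rcases lt_trichotomy k (β.mate k) with hlt | he | hlt
      · rw [if_neg (by omega)]
        by_cases hik : i ≤ k
        · exact (zero k hk hlt hik).1
        · exact (key k hk hlt).2.2 (by omega)
      · rw [if_neg (by omega), ← hD.mulVec_sign hS hk he.symm x]
        exact h1 _ (by omega)
      · have e := key (β.mate k) (hβ.mate_outside hk) (by rwa [β.mate_invol])
        have z := zero (β.mate k) (hβ.mate_outside hk) (by rwa [β.mate_invol])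
        rw [β.mate_invol] at e z
        split_ifs with hc
        · exact e.2.1 (by omega)
        · by_cases hik : i ≤ β.mate k
          · exact (z hik).2
          · rw [e.2.1 (by omega), e.2.2 (by omega)]
  · rintro ⟨⟨h1, h2⟩, h3⟩
    have h3 : ∀ k, (∀ a, ι a ≠ k) → ¬ ((k : ℕ) < i ∧ (β.mate k : ℕ) < j) →
        x k = if ((β.mate k : ℕ) < i ∧ (k : ℕ) < j) then x (β.mate k) else 0 := by
      intro k hk hkH
      rw [h3 k hk (by rwa [hH k hk]), if_congr (hH (β.mate k) (hβ.mate_outside hk)) rfl rfl,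
        β.mate_invol]
    have h3' : ∀ l, (∀ a, ι a ≠ l) → ¬ ((β.mate l : ℕ) < i ∧ (l : ℕ) < j) →
        x (β.mate l) = if ((l : ℕ) < i ∧ (β.mate l : ℕ) < j) then x l else 0 := by
      intro l hl hlH
      have := h3 (β.mate l) (hβ.mate_outside hl)
      rw [β.mate_invol] at this
      exact this hlH
    refine ⟨fun m hm => ?_, fun m hm => ?_⟩
    · by_cases hmι : ∃ a, ι a = m
      · obtain ⟨a, rfl⟩ := hmι
        rw [hD.mulVec_apply hβ]
        exact h1 _ (by have := hi a; omega)
      push Not at hmι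
      rcases lt_trichotomy m (β.mate m) with hlt | he | hlt
      · rw [mulVec_left hS hlt, h3 m hmι (by omega), h3' m hmι (by omega), if_neg (by omega),
          if_neg (by omega), add_zero]
      · rw [hD.mulVec_sign hS hmι he.symm, h3 m hmι (by omega), if_neg (by omega)]
      · have e := hD.mulVec_right hβ hS (hβ.mate_outside hmι) (by rwa [β.mate_invol]) x
        rw [β.mate_invol] at e
        rw [e, h3 m hmι (by omega)]
        split_ifs with hc
        · ring
        · rw [h3' m hmι (by omega), if_neg (by omega)]
          ring
    · by_cases hmι : ∃ a, ι a = m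
      · obtain ⟨a, rfl⟩ := hmι
        rw [hD.mulVec_apply hβ, part_comp hβ]
        exact h2 _ (by have := hj a; omega)
      push Not at hmι
      rcases lt_trichotomy m (β.mate m) with hlt | he | hlt
      · rw [mulVec_left hS hlt, (hpos hlt).1, (hpos hlt).2, h3 m hmι (by omega), if_neg (by omega),
          add_zero]
      · have e : x m = 0 := by rw [h3 m hmι (by omega), if_neg (by omega)]
        rw [hD.mulVec_sign hS hmι he.symm, part, e, ite_self]
      · have hlt' : β.mate m < β.mate (β.mate m) := by rwa [β.mate_invol]
        have e := hD.mulVec_right hβ hS (hβ.mate_outside hmι) hlt' (part β.IsPos x)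
        rw [(hpos hlt').1, (hpos hlt').2, β.mate_invol] at e
        rw [e, h3' m hmι (by omega), if_neg (by omega)]
        simp

theorem finrank_partKer (hD : Decoupled β ι N) (hβ : Pattern β α ι) (hS : Slice β N)
    {T : Fin (r + s) → Prop} {T' : Fin (p + q) → Prop} (hT : ∀ a, T' a ↔ T (ι a))
    (hT' : T = β.IsPos ∨ T = fun k => ¬ β.IsPos k)
    {i i' : ℕ} (hi : ∀ a : Fin (p + q), (a : ℕ) < i' ↔ (ι a : ℕ) < i) :
    Module.finrank ℂ (partKer N T i) = Module.finrank ℂ (partKer (N.submatrix ι ι) T' i') +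
      ((outside ι).filter fun k => T k ∧ (k : ℕ) < i ∧ (β.mate k : ℕ) < i).card := by
  refine finrank_eq_finrank_add_card hβ.1.injective (Finset.filter_subset _ _) id fun x => ?_
  have hT2 : ∀ k, k < β.mate k → ¬ T k ∨ ¬ T (β.mate k) := by
    intro k hk
    rcases hT' with rfl | rfl
    · exact Or.inr (not_isPos_mate hk)
    · exact Or.inl (not_not.2 (isPos_of_lt hk))
  have hH : ∀ k : Fin (r + s), (∀ a, ι a ≠ k) →
      (k ∈ ((outside ι).filter fun k => T k ∧ (k : ℕ) < i ∧ (β.mate k : ℕ) < i) ↔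
      (T k ∧ (k : ℕ) < i ∧ (β.mate k : ℕ) < i)) := fun k hk => by
    rw [Finset.mem_filter, mem_outside, and_iff_right hk]
  constructor
  · rintro ⟨h1, h2⟩
    refine ⟨⟨fun a ha => h1 _ (mt (hT a).2 ha), fun a ha => ?_⟩, fun k hk hkH => ?_⟩
    · rw [← hD.mulVec_apply hβ]
      exact h2 _ (by have := hi a; omega)
    · rw [id, if_neg hkH]
      rw [hH k hk] at hkH
      by_cases hTk : T k
      swap
      · exact h1 k hTk
      have key : ∀ l, (∀ a, ι a ≠ l) → l < β.mate l → i ≤ β.mate l → x l = 0 ∧ x (β.mate l) = 0 := by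
        intro l hl hlt h
        have := h2 _ h
        rw [hD.mulVec_right hβ hS hl hlt] at this
        rcases hT2 l hlt with h' | h'
        · rw [h1 _ h', neg_zero, zero_add] at this
          exact ⟨h1 _ h', this⟩
        · rw [h1 _ h', add_zero, neg_eq_zero] at this
          exact ⟨this, h1 _ h'⟩
      rcases lt_trichotomy k (β.mate k) with hlt | he | hlt
      · exact (key k hk hlt (by by_contra; apply hkH; exact ⟨hTk, by omega, by omega⟩)).1
      · rw [← hD.mulVec_sign hS hk he.symm x]
        exact h2 _ (by by_contra; apply hkH; exact ⟨hTk, by omega, by omega⟩)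
      · have := key (β.mate k) (hβ.mate_outside hk) (by rwa [β.mate_invol])
        rw [β.mate_invol] at this
        exact (this (by by_contra; apply hkH; exact ⟨hTk, by omega, by omega⟩)).2
  · rintro ⟨⟨h1, h2⟩, h3⟩
    have h3 : ∀ k, (∀ a, ι a ≠ k) → ¬ (T k ∧ (k : ℕ) < i ∧ (β.mate k : ℕ) < i) → x k = 0 := by
      intro k hk hkH
      rw [← hH k hk] at hkH
      rw [h3 k hk hkH, id, if_neg hkH]
    have h3' : ∀ k, (∀ a, ι a ≠ k) → i ≤ k → x k = 0 ∧ x (β.mate k) = 0 := fun k hk h =>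
      ⟨h3 k hk (by omega), h3 _ (hβ.mate_outside hk) (by rw [β.mate_invol]; omega)⟩
    refine ⟨fun k hk => ?_, fun m hm => ?_⟩
    · by_cases hkι : ∃ a, ι a = k
      · obtain ⟨a, rfl⟩ := hkι
        exact h1 a (mt (hT a).1 hk)
      · push Not at hkι
        exact h3 k hkι fun h => hk h.1
    · by_cases hmι : ∃ a, ι a = m
      · obtain ⟨a, rfl⟩ := hmι
        rw [hD.mulVec_apply hβ]
        exact h2 _ (by have := hi a; omega)
      push Not at hmι
      obtain ⟨e1, e2⟩ := h3' m hmι hm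
      rcases lt_trichotomy m (β.mate m) with hlt | he | hlt
      · rw [mulVec_left hS hlt, e1, e2, add_zero]
      · rw [hD.mulVec_sign hS hmι he.symm, e1]
      · have e := hD.mulVec_right hβ hS (hβ.mate_outside hmι) (by rwa [β.mate_invol]) x
        rw [β.mate_invol] at e
        rw [e, e1, e2, neg_zero, add_zero]

end Decoupled

namespace IntervalEmbed

variable {α γ : Clan p q} {β θ : Clan r s} {ι : Fin (p + q) → Fin (r + s)}

theorem isPos_outside (h : IntervalEmbed α γ β θ ι) {k : Fin (r + s)} (hk : ∀ a, ι a ≠ k) :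
    β.IsPos k ↔ θ.IsPos k := by
  rw [IsPos, IsPos, IsPlus, IsPlus, IsLeft, IsLeft, (h.2.2.1 k hk).1, (h.2.2.1 k hk).2]

theorem closedCard_eq (h : IntervalEmbed α γ β θ ι) {T : Fin (r + s) → Prop}
    {T' : Fin (p + q) → Prop} {U : Fin (r + s) → Prop} (hT : ∀ a, T (ι a) ↔ T' a)
    (hU : ∀ k, (∀ a, ι a ≠ k) → (T k ↔ U k)) {i i' : ℕ}
    (hi : ∀ a : Fin (p + q), (a : ℕ) < i' ↔ (ι a : ℕ) < i) :
    closedCard θ T i = closedCard γ T' i' +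
      ((outside ι).filter fun k => U k ∧ (k : ℕ) < i ∧ (β.mate k : ℕ) < i).card := by
  rw [closedCard, closedCard, card_filter_eq_comp_add_outside h.1.1.injective]
  refine congrArg₂ _ (congrArg _ (Finset.filter_congr fun a _ => ?_))
    (congrArg _ (Finset.filter_congr fun k hk => ?_))
  · rw [h.1.mate_apply, hT, hi, hi]
  · rw [hU k (mem_outside.1 hk), (h.2.2.1 k (mem_outside.1 hk)).1]

theorem closedSet_card (h : IntervalEmbed α γ β θ ι) {i j i' j' : ℕ}
    (hi : ∀ a : Fin (p + q), (a : ℕ) < i' ↔ (ι a : ℕ) < i)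
    (hj : ∀ a : Fin (p + q), (a : ℕ) < j' ↔ (ι a : ℕ) < j) :
    (θ.closedSet i j).card = (γ.closedSet i' j').card +
      ((outside ι).filter fun k : Fin (r + s) => (k : ℕ) < i ∧ (β.mate k : ℕ) < j).card := by
  rw [closedSet, closedSet, card_filter_eq_comp_add_outside h.1.1.injective]
  refine congrArg₂ _ (congrArg _ (Finset.filter_congr fun a _ => ?_))
    (congrArg _ (Finset.filter_congr fun k hk => ?_))
  · rw [h.1.mate_apply, hi, hj]
  · rw [(h.2.2.1 k (mem_outside.1 hk)).1]

end IntervalEmbed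

theorem exists_threshold_of_strictMono {m n : ℕ} {f : Fin m → Fin n} (hf : StrictMono f) :
    ∃ g : ℕ → ℕ, Monotone g ∧ (∀ i, g i ≤ m) ∧ ∀ i (a : Fin m), (a : ℕ) < g i ↔ (f a : ℕ) < i := by
  refine ⟨fun i => (Finset.univ.filter fun a => (f a : ℕ) < i).card, fun i j hij => ?_,
    fun i => (Finset.card_le_univ _).trans_eq (Fintype.card_fin m), fun i a => ⟨fun h => ?_, fun h => ?_⟩⟩
  · exact Finset.card_le_card (Finset.monotone_filter_right _ fun a _ h => lt_of_lt_of_le h hij)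
  · by_contra hc
    refine h.not_ge ?_
    rw [← Fin.card_Iio a]
    refine Finset.card_le_card fun b hb => ?_
    rw [Finset.mem_filter] at hb
    rw [Finset.mem_Iio, ← hf.lt_iff_lt]
    exact Fin.lt_def.2 (by omega)
  · rw [Nat.lt_iff_add_one_le, ← Fin.card_Iic a]
    refine Finset.card_le_card fun b hb => ?_
    rw [Finset.mem_filter]
    exact ⟨Finset.mem_univ _, (Fin.le_def.1 (hf.monotone (Finset.mem_Iic.1 hb))).trans_lt h⟩

theorem exists_threshold_of_strictMono' {m n : ℕ} {f : Fin m → Fin n} (hf : StrictMono f) :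
    ∃ g : ℕ → ℕ, Monotone g ∧ (∀ i, g i ≤ n) ∧
      ∀ i, i ≤ m → ∀ a : Fin m, (a : ℕ) < i ↔ (f a : ℕ) < g i := by
  refine ⟨fun i => if h : i < m then (f ⟨i, h⟩ : ℕ) else n, fun i j hij => ?_, fun i => ?_,
    fun i hi a => ?_⟩
  · dsimp only
    split_ifs with h1 h2
    · exact hf.monotone (Fin.le_def.2 hij)
    · exact (f _).2.le
    · omega
    · exact le_rfl
  · dsimp only
    split_ifs
    · exact (f _).2.le
    · exact le_rfl
  · dsimp only
    split_ifs with h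
    · exact (hf.lt_iff_lt (a := a) (b := ⟨i, h⟩)).symm
    · have := a.2
      have := (f a).2
      omega

theorem Slice.submatrix {α : Clan p q} {β : Clan r s} {ι : Fin (p + q) → Fin (r + s)}
    {N : Matrix (Fin (r + s)) (Fin (r + s)) ℂ} (hS : Slice β N) (hβ : Pattern β α ι) :
    Slice α (N.submatrix ι ι) := by
  have lt : ∀ {a b}, a < b → ι a < ι b := fun h => hβ.1 h
  have lt1 : ∀ {a b}, a < α.mate b → ι a < β.mate (ι b) := fun h => by
    rw [hβ.mate_apply]; exact hβ.1 h
  have lt2 : ∀ {a b}, α.mate a < b → β.mate (ι a) < ι b := fun h => by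
    rw [hβ.mate_apply]; exact hβ.1 h
  have ne : ∀ {a b}, a ≠ b → ι a ≠ ι b := fun h => hβ.1.injective.ne h
  refine ⟨fun i => hS.diag _, fun i hi => ?_, fun i hi => ?_,
    fun i k hi hk hki => hS.plus_row _ _ ((hβ.isPlus_iff i).2 hi) ((hβ.isPos_iff k).2 hk) (ne hki),
    fun i k hi hk hki => hS.minus_row _ _ ((hβ.isMinus_iff i).2 hi) (mt (hβ.isPos_iff k).1 hk)
      (ne hki),
    fun i k hi hk hk' => hS.left_row _ _ (lt1 hi) (ne hk) (by rw [hβ.mate_apply]; exact ne hk'),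
    fun x k h h' => hS.above _ _ (lt h) (lt1 h'), fun x k h h' => hS.between _ _ (lt h) (lt1 h'),
    fun x k h h' => hS.between' _ _ (lt2 h) (lt h'), fun i k h h1 h2 => ?_,
    fun i j h h1 h2 => ?_⟩
  · have := hS.left _ (lt1 hi)
    rwa [hβ.mate_apply] at this
  · have := hS.right _ (lt1 hi)
    rwa [hβ.mate_apply] at this
  · have := hS.right_row _ _ (lt1 h) (lt h1) (lt1 h2)
    rwa [hβ.mate_apply] at this
  · have := hS.cross (ι i) (ι j) (lt h) (lt1 h1) (by
      rw [hβ.mate_apply, hβ.mate_apply]; exact lt h2)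
    rwa [hβ.mate_apply, hβ.mate_apply] at this

theorem IntervalEmbed.relabelledMarsSpringer_iff {α γ : Clan p q} {β θ : Clan r s}
    {ι : Fin (p + q) → Fin (r + s)} (h : IntervalEmbed α γ β θ ι)
    {N : Matrix (Fin (r + s)) (Fin (r + s)) ℂ} (hD : Decoupled β ι N) (hS : Slice β N) :
    RelabelledMarsSpringer θ β N ↔ RelabelledMarsSpringer γ α (N.submatrix ι ι) := by
  obtain ⟨hθ, hβ, hag, -⟩ := id h
  have pos : ∀ {i i' : ℕ}, (∀ a : Fin (p + q), (a : ℕ) < i' ↔ (ι a : ℕ) < i) →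
      (closedCard θ θ.IsPos i ≤ Module.finrank ℂ (partKer N β.IsPos i) ↔
      closedCard γ γ.IsPos i' ≤ Module.finrank ℂ (partKer (N.submatrix ι ι) α.IsPos i')) := by
    intro i i' hi
    rw [hD.finrank_partKer hβ hS (fun a => (hβ.isPos_iff a).symm) (Or.inl rfl) hi,
      h.closedCard_eq hθ.isPos_iff (fun k hk => (h.isPos_outside hk).symm) hi,
      add_le_add_iff_right]
  have neg : ∀ {i i' : ℕ}, (∀ a : Fin (p + q), (a : ℕ) < i' ↔ (ι a : ℕ) < i) →
      (closedCard θ (fun k => ¬ θ.IsPos k) i ≤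
        Module.finrank ℂ (partKer N (fun k => ¬ β.IsPos k) i) ↔
      closedCard γ (fun k => ¬ γ.IsPos k) i' ≤
        Module.finrank ℂ (partKer (N.submatrix ι ι) (fun k => ¬ α.IsPos k) i')) := by
    intro i i' hi
    rw [hD.finrank_partKer hβ hS (T' := fun k => ¬ α.IsPos k)
        (fun a => not_congr (hβ.isPos_iff a).symm) (Or.inr rfl) hi,
      h.closedCard_eq (T' := fun k => ¬ γ.IsPos k) (U := fun k => ¬ β.IsPos k)
        (fun a => not_congr (hθ.isPos_iff a)) (fun k hk => not_congr (h.isPos_outside hk).symm) hi,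
      add_le_add_iff_right]
  have flag : ∀ {i j i' j' : ℕ}, i ≤ j → (∀ a : Fin (p + q), (a : ℕ) < i' ↔ (ι a : ℕ) < i) →
      (∀ a : Fin (p + q), (a : ℕ) < j' ↔ (ι a : ℕ) < j) →
      ((θ.closedSet i j).card ≤ Module.finrank ℂ (flagKer β N i j) ↔
      (γ.closedSet i' j').card ≤ Module.finrank ℂ (flagKer α (N.submatrix ι ι) i' j')) := by
    intro i j i' j' hij hi hj
    rw [hD.finrank_flagKer hβ hS hij hi hj, h.closedSet_card hi hj]
    exact Nat.add_le_add_iff_right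
  constructor
  · intro hN
    obtain ⟨g, hg, hgn, hgi⟩ := exists_threshold_of_strictMono' hβ.1
    exact ⟨hS.submatrix hβ, fun i hi => (pos (hgi i hi)).1 (hN.pos _ (hgn i)),
      fun i hi => (neg (hgi i hi)).1 (hN.neg _ (hgn i)),
      fun i j hij hj => (flag (hg hij) (hgi i (hij.trans hj)) (hgi j hj)).1
        (hN.flag _ _ (hg hij) (hgn j))⟩
  · intro hN
    obtain ⟨g, hg, hgn, hgi⟩ := exists_threshold_of_strictMono hβ.1
    exact ⟨hS, fun i _ => (pos (hgi i)).2 (hN.pos _ (hgn i)),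
      fun i _ => (neg (hgi i)).2 (hN.neg _ (hgn i)),
      fun i j hij _ => (flag hij (hgi i) (hgi j)).2 (hN.flag _ _ (hg hij) (hgn j))⟩

/-- The extension of a matrix indexed by the positions of a pattern to all positions of `c`, whose
entries outside the pattern agree with those of the base point. -/
def extendMatrix (c : Clan r s) (ι : Fin (p + q) → Fin (r + s))
    (N : Matrix (Fin (p + q)) (Fin (p + q)) ℂ) : Matrix (Fin (r + s)) (Fin (r + s)) ℂ :=
  fun i k => if h : (∃ a, ι a = i) ∧ ∃ b, ι b = k then N h.1.choose h.2.choose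
    else if i = k then 1 else if k = c.mate i then (if i < k then 1 else -1) else 0

section extendMatrix

variable {c : Clan r s} {ι : Fin (p + q) → Fin (r + s)} {N : Matrix (Fin (p + q)) (Fin (p + q)) ℂ}

theorem extendMatrix_apply (hι : Function.Injective ι) (a b : Fin (p + q)) :
    extendMatrix c ι N (ι a) (ι b) = N a b := by
  have h : (∃ a', ι a' = ι a) ∧ ∃ b', ι b' = ι b := ⟨⟨a, rfl⟩, b, rfl⟩
  rw [extendMatrix, dif_pos h, hι h.1.choose_spec, hι h.2.choose_spec]

theorem extendMatrix_outside {i k : Fin (r + s)} (h : ¬ ((∃ a, ι a = i) ∧ ∃ b, ι b = k)) :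
    extendMatrix c ι N i k =
      if i = k then 1 else if k = c.mate i then (if i < k then 1 else -1) else 0 :=
  dif_neg h

theorem extendMatrix_eq_zero (hι : Function.Injective ι) {i k : Fin (r + s)} (hik : i ≠ k)
    (hik' : k ≠ c.mate i) (h : ∀ a b, ι a = i → ι b = k → N a b = 0) :
    extendMatrix c ι N i k = 0 := by
  by_cases hc : (∃ a, ι a = i) ∧ ∃ b, ι b = k
  · obtain ⟨⟨a, rfl⟩, b, rfl⟩ := hc
    rw [extendMatrix_apply hι, h a b rfl rfl]
  · rw [extendMatrix_outside hc, if_neg hik, if_neg hik']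

theorem decoupled_extendMatrix : Decoupled c ι (extendMatrix c ι N) := by
  intro j hj k hk hk'
  have hj' : ¬ ∃ a, ι a = j := fun ⟨a, ha⟩ => hj a ha
  rw [extendMatrix_outside fun h => hj' h.1, extendMatrix_outside fun h => hj' h.2, if_neg hk.symm,
    if_neg hk', if_neg hk, if_neg fun e => hk' (by rw [e, c.mate_invol])]
  exact ⟨rfl, rfl⟩

theorem Slice.extendMatrix {α : Clan p q} (hS : Slice α N) (hβ : Pattern c α ι) :
    Slice c (extendMatrix c ι N) := by
  have hι := hβ.1.injective
  have inv := c.mate_invol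
  have lt : ∀ {a b}, ι a < ι b → a < b := hβ.1.lt_iff_lt.1
  have lt1 : ∀ {a b}, ι a < c.mate (ι b) → a < α.mate b := fun h => by
    rw [hβ.mate_apply] at h; exact lt h
  have lt2 : ∀ {a b}, c.mate (ι a) < ι b → α.mate a < b := fun h => by
    rw [hβ.mate_apply] at h; exact lt h
  have mem_mate : ∀ {i}, (∃ a, ι a = c.mate i) → ∃ a, ι a = i := fun {i} ⟨a, ha⟩ =>
    ⟨α.mate a, by rw [← hβ.mate_apply, ha, inv]⟩
  have eq_mate : ∀ {a i}, ι a = c.mate i → i = ι (α.mate a) := fun {a i} h => by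
    rw [← hβ.mate_apply, h, inv]
  have mate_ne : ∀ {i k}, k ≠ c.mate i → c.mate k ≠ i := fun {i k} h e => h (by rw [← e, inv])
  refine ⟨fun i => ?_, fun i hi => ?_, fun i hi => ?_, fun i k hi hk hki => ?_,
    fun i k hi hk hki => ?_, fun i k hi hk hk' => ?_, fun x k h h' => ?_, fun x k h h' => ?_,
    fun x k h h' => ?_, fun i k h h1 h2 => ?_, fun i j h h1 h2 => ?_⟩
  · by_cases hc : ∃ a, ι a = i
    · obtain ⟨a, rfl⟩ := hc
      rw [extendMatrix_apply hι, hS.diag]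
    · rw [extendMatrix_outside fun h => hc h.1, if_pos rfl]
  · by_cases hc : ∃ a, ι a = i
    · obtain ⟨a, rfl⟩ := hc
      rw [hβ.mate_apply, extendMatrix_apply hι, hS.left a (lt1 hi)]
    · rw [extendMatrix_outside fun h => hc h.1, if_neg hi.ne, if_pos rfl, if_pos hi]
  · by_cases hc : ∃ a, ι a = i
    · obtain ⟨a, rfl⟩ := hc
      rw [hβ.mate_apply, extendMatrix_apply hι, hS.right a (lt1 hi)]
    · rw [extendMatrix_outside fun h => hc h.2, if_neg hi.ne', if_pos (inv i).symm,
        if_neg hi.not_gt]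
  · refine extendMatrix_eq_zero hι hki.symm (by rwa [hi.1]) ?_
    rintro a b rfl rfl
    exact hS.plus_row _ _ ((hβ.isPlus_iff a).1 hi) ((hβ.isPos_iff b).1 hk) (hι.ne_iff.1 hki)
  · refine extendMatrix_eq_zero hι hki.symm (by rwa [hi.1]) ?_
    rintro a b rfl rfl
    exact hS.minus_row _ _ ((hβ.isMinus_iff a).1 hi) (mt (hβ.isPos_iff b).2 hk) (hι.ne_iff.1 hki)
  · refine extendMatrix_eq_zero hι hk.symm hk' ?_
    rintro a b rfl rfl
    rw [hβ.mate_apply] at hk'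
    exact hS.left_row _ _ (lt1 hi) (hι.ne_iff.1 hk) (hι.ne_iff.1 hk')
  · refine extendMatrix_eq_zero hι h.ne (fun e => ?_) ?_
    · rw [e, inv] at h'
      exact h'.false
    · rintro a b rfl rfl
      exact hS.above _ _ (lt h) (lt1 h')
  · refine extendMatrix_eq_zero hι h.ne' (fun e => ?_) ?_
    · rw [e, inv] at h'
      exact h'.false
    · rintro a b rfl rfl
      exact hS.between _ _ (lt h) (lt1 h')
  · refine extendMatrix_eq_zero hι h'.ne (fun e => ?_) ?_
    · rw [e, inv] at h
      exact h.false
    · rintro a b rfl rfl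
      exact hS.between' _ _ (lt2 h) (lt h')
  · refine extendMatrix_eq_zero hι (fun e => ?_) (by rw [inv]; exact h1.ne') ?_
    · rw [← e, inv] at h2
      exact h2.false
    · rintro a b ha rfl
      obtain rfl := eq_mate ha
      rw [← hβ.mate_apply, inv] at ha
      have := hS.right_row (α.mate a) b (lt1 h) (lt h1) (lt1 h2)
      rwa [α.mate_invol] at this
  · by_cases hc : (∃ a, ι a = j) ∧ ∃ b, ι b = i
    · obtain ⟨⟨a, rfl⟩, b, rfl⟩ := hc
      rw [hβ.mate_apply, hβ.mate_apply, extendMatrix_apply hι, extendMatrix_apply hι]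
      rw [hβ.mate_apply, hβ.mate_apply] at h2
      exact hS.cross b a (lt h) (lt1 h1) (lt h2)
    · rw [extendMatrix_outside fun h => hc ⟨mem_mate h.1, mem_mate h.2⟩,
        extendMatrix_outside fun h => hc ⟨mem_mate h.1, h.2⟩, if_neg h2.ne', inv, if_neg h1.ne',
        if_neg (h.trans (h1.trans h2)).ne', if_neg h.ne, neg_zero]

end extendMatrix

theorem Decoupled.eq_of_submatrix_eq {c : Clan r s} {ι : Fin (p + q) → Fin (r + s)}
    {N₁ N₂ : Matrix (Fin (r + s)) (Fin (r + s)) ℂ} (h₁ : Decoupled c ι N₁) (h₂ : Decoupled c ι N₂)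
    (hS₁ : Slice c N₁) (hS₂ : Slice c N₂) (h : N₁.submatrix ι ι = N₂.submatrix ι ι) : N₁ = N₂ := by
  have row : ∀ i, (∀ a, ι a ≠ i) → ∀ k, N₁ i k = N₂ i k := by
    intro i hi k
    by_cases hk : k = i
    · rw [hk, hS₁.diag, hS₂.diag]
    by_cases hk' : k = c.mate i
    · rcases lt_or_gt_of_ne hk with hlt | hlt
      · have hi' : i = c.mate k := by rw [hk', c.mate_invol]
        rw [hi'] at hlt ⊢
        rw [hS₁.right k hlt, hS₂.right k hlt]
      · rw [hk'] at hlt ⊢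
        rw [hS₁.left i hlt, hS₂.left i hlt]
    · rw [(h₁ i hi k hk hk').1, (h₂ i hi k hk hk').1]
  ext i k
  by_cases hi : ∃ a, ι a = i
  · by_cases hk : ∃ b, ι b = k
    · obtain ⟨⟨a, rfl⟩, b, rfl⟩ := And.intro hi hk
      exact congrFun (congrFun h a) b
    · push Not at hk
      by_cases hik : i = c.mate k
      · have := row k hk i
        rw [hik] at this ⊢
        rcases lt_trichotomy k (c.mate k) with hlt | he | hlt
        · rw [hS₁.right k hlt, hS₂.right k hlt]
        · rw [← he, hS₁.diag, hS₂.diag]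
        · have hlt' : c.mate k < c.mate (c.mate k) := by rwa [c.mate_invol]
          have e₁ := hS₁.left _ hlt'
          have e₂ := hS₂.left _ hlt'
          rw [c.mate_invol] at e₁ e₂
          rw [e₁, e₂]
      · obtain ⟨a, rfl⟩ := hi
        rw [(h₁ k hk _ (hk a) hik).2, (h₂ k hk _ (hk a) hik).2]
  · push Not at hi
    exact row i hi k

theorem Pattern.apply_wPerm {α : Clan p q} {β : Clan r s} {ι : Fin (p + q) → Fin (r + s)}
    (h : Pattern β α ι) {κ : Fin (p + q) → Fin (r + s)} (hκ : StrictMono κ)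
    (hκrange : ∀ c, (∃ b, κ b = c) ↔ ∀ j, (∀ k, ι k ≠ j) → (c : ℕ) ≠ β.wNat j)
    (b : Fin (p + q)) : κ (α.wPerm b) = β.wPerm (ι b) := by
  have key : ∀ a b, α.wNat a < α.wNat b → β.wNat (ι a) < β.wNat (ι b) := by
    intro a b hab
    by_cases ha : α.IsPos a
    · have ha' := (h.isPos_iff a).2 ha
      by_cases hb : α.IsPos b
      · rw [wNat_lt_wNat_of_isPos ha hb] at hab
        exact (wNat_lt_wNat_of_isPos ha' ((h.isPos_iff b).2 hb)).2 (h.1 hab)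
      · have h1 := (wNat_lt_iff_of_isPos (c := β) (k := ι a)).2 ha'
        have h2 := mt (wNat_lt_iff_of_isPos (c := β) (k := ι b)).1 (mt (h.isPos_iff b).1 hb)
        omega
    · by_cases hb : α.IsPos b
      · have h1 := mt (wNat_lt_iff_of_isPos (c := α) (k := a)).1 ha
        have h2 := (wNat_lt_iff_of_isPos (c := α) (k := b)).2 hb
        omega
      · rw [wNat_lt_wNat_of_not_isPos ha hb] at hab
        rw [wNat_lt_wNat_of_not_isPos (mt (h.isPos_iff a).1 ha) (mt (h.isPos_iff b).1 hb),
          h.mate_apply, h.mate_apply]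
        exact h.1 hab
  have mono : StrictMono fun c => β.wPerm (ι (α.wPerm.symm c)) := by
    intro c d hcd
    refine Fin.lt_def.2 (key _ _ ?_)
    rw [← wPerm_val, ← wPerm_val, Equiv.apply_symm_apply, Equiv.apply_symm_apply]
    exact hcd
  have range : Set.range κ = Set.range fun c => β.wPerm (ι (α.wPerm.symm c)) := by
    ext d
    rw [Set.mem_range, hκrange]
    constructor
    · intro hd
      by_contra hc
      refine hd (β.wPerm.symm d) (fun k hk => hc ⟨α.wPerm k, ?_⟩) ?_
      · simp [hk]
      · rw [← wPerm_val, Equiv.apply_symm_apply]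
    · rintro ⟨c, rfl⟩ j hj he
      rw [← wPerm_val] at he
      exact hj _ (β.wPerm.injective (Fin.ext he))
  have := congrFun ((hκ.range_inj mono).1 range) (α.wPerm b)
  rw [this, Equiv.symm_apply_apply]

theorem submatrix_id_injective {n : ℕ} (w : Equiv.Perm (Fin n)) :
    Function.Injective fun M : Matrix (Fin n) (Fin n) ℂ => M.submatrix id w := by
  intro M₁ M₂ h
  ext i k
  have := congrFun (congrFun h i) (w.symm k)
  simpa using this

end Clan

/-- given an interval pattern embedding `[α,γ] ↪ [β,θ]` via `ι`, the map `Ψ`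
deleting the rows `j` and the columns `w_β(j)` for all `j` outside the index set (rows kept
via `ι`, columns kept via the order embedding `κ` onto the complement of the deleted columns)
restricts to a bijection from `N_{θ,β}` onto `N_{γ,α}`. -/
theorem mars_springer_iso {p q r s : ℕ} (α γ : Clan p q) (β θ : Clan r s)
    (ι : Fin (p + q) → Fin (r + s))
    (hαγ : Clan.ble α γ) (hβθ : Clan.ble β θ)
    (hemb : Clan.IntervalEmbed α γ β θ ι)
    (κ : Fin (p + q) → Fin (r + s)) (hκ : StrictMono κ)
    (hκrange : ∀ c : Fin (r + s),
      (∃ b, κ b = c) ↔ ∀ j : Fin (r + s), (∀ k, ι k ≠ j) → (c : ℕ) ≠ β.wNat j) :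
    Set.BijOn
      (fun M : Matrix (Fin (r + s)) (Fin (r + s)) ℂ =>
        (Matrix.of fun a b => M (ι a) (κ b) : Matrix (Fin (p + q)) (Fin (p + q)) ℂ))
      {M | Clan.MarsSpringer θ β M} {M | Clan.MarsSpringer γ α M} := by
  obtain ⟨-, hβ, -, -⟩ := id hemb
  have hw : ∀ M : Matrix (Fin (r + s)) (Fin (r + s)) ℂ,
      (Matrix.of fun a b => M (ι a) (κ b) : Matrix (Fin (p + q)) (Fin (p + q)) ℂ).submatrix id
        α.wPerm = (M.submatrix id β.wPerm).submatrix ι ι := by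
    intro M
    ext a b
    exact congrArg (M (ι a)) (hβ.apply_wPerm hκ hκrange b)
  refine ⟨fun M hM => ?_, fun M₁ hM₁ M₂ hM₂ h => ?_, fun M' hM' => ?_⟩
  · have hN := Clan.marsSpringer_iff.1 hM
    refine Clan.marsSpringer_iff.2 ?_
    rw [hw]
    exact (hemb.relabelledMarsSpringer_iff (hemb.decoupled hβθ hN) hN.slice).1 hN
  · have hN₁ := Clan.marsSpringer_iff.1 hM₁
    have hN₂ := Clan.marsSpringer_iff.1 hM₂
    refine Clan.submatrix_id_injective β.wPerm ((hemb.decoupled hβθ hN₁).eq_of_submatrix_eq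
      (hemb.decoupled hβθ hN₂) hN₁.slice hN₂.slice ?_)
    rw [← hw, ← hw]
    exact congrArg (fun M : Matrix _ _ ℂ => M.submatrix id α.wPerm) h
  · have hN' := Clan.marsSpringer_iff.1 hM'
    set N := Clan.extendMatrix β ι (M'.submatrix id α.wPerm) with hN
    have hNsub : N.submatrix ι ι = M'.submatrix id α.wPerm := by
      ext a b
      exact Clan.extendMatrix_apply hβ.1.injective a b
    have hM : (N.submatrix id β.wPerm.symm).submatrix id β.wPerm = N := by
      ext i k
      simp
    refine ⟨N.submatrix id β.wPerm.symm, Clan.marsSpringer_iff.2 ?_,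
      Clan.submatrix_id_injective α.wPerm ?_⟩
    · rw [hM, hemb.relabelledMarsSpringer_iff Clan.decoupled_extendMatrix
        (hN'.slice.extendMatrix hβ), hNsub]
      exact hN'
    · exact (hw _).trans (by rw [hM, hNsub])
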